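/- Let δ ≥ 1, let N be an admissible norm with constant C_N, and let H_p, H_q be proper, geodesically complete, δ-hyperbolic, Busemann spaces. Set C₀ = (2853δC_N + 2^{851})². Let x = (x_p,x_q) and y = (y_p,y_q) be points of H = H_p⋈H_q with h(x) ≤ h(y), and let α be a geodesic of (H, d_{H,N}) from x to y. Then: (1) | h⁻(α) − ( h(x) − ½·d_r(x_q,y_q) ) | ≤ 4C₀; (2) | h⁺(α) − ( h(y) + ½·d_r(x_p,y_p) ) | ≤ 4C₀. -/

import Mathlib

open Set Filter
open scoped ENNReal NNReal

noncomputable section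

namespace HP

variable {H : Type*} [MetricSpace H]

/-- `γ` restricted to `I` is an arclength-parametrised (isometric) geodesic. -/
def IsGeodesicOn (γ : ℝ → H) (I : Set ℝ) : Prop :=
  ∀ s ∈ I, ∀ t ∈ I, dist (γ s) (γ t) = |s - t|

/-- A geodesic line of `H`. -/
def IsGeodesicLine (γ : ℝ → H) : Prop := IsGeodesicOn γ Set.univ

/-- A geodesic ray of `H`, parametrised on `[0,∞)`. -/
def IsGeodesicRay (γ : ℝ → H) : Prop := IsGeodesicOn γ (Set.Ici 0)

/-- A geodesic ray starting at `w`. -/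
def IsRayFrom (w : H) (γ : ℝ → H) : Prop := IsGeodesicRay γ ∧ γ 0 = w

/-- A geodesic segment from `x` to `y`, parametrised on `[0, dist x y]`. -/
def IsGeodSegment (γ : ℝ → H) (x y : H) : Prop :=
  IsGeodesicOn γ (Set.Icc 0 (dist x y)) ∧ γ 0 = x ∧ γ (dist x y) = y

/-- The traces on `[0,∞)` of two rays are at finite Hausdorff distance. -/
def FinHausRays (γ₁ γ₂ : ℝ → H) : Prop :=
  ∃ C : ℝ, (∀ s : ℝ, 0 ≤ s → ∃ t : ℝ, 0 ≤ t ∧ dist (γ₁ s) (γ₂ t) ≤ C) ∧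
           (∀ t : ℝ, 0 ≤ t → ∃ s : ℝ, 0 ≤ s ∧ dist (γ₁ s) (γ₂ t) ≤ C)

/-- A geodesic metric space: any two points are joined by a geodesic segment. -/
def GeodesicSpace (H : Type*) [MetricSpace H] : Prop :=
  ∀ x y : H, ∃ γ : ℝ → H, IsGeodSegment γ x y

/-- `δ`-hyperbolicity: geodesic space all of whose geodesic triangles are `δ`-slim,
i.e. each side is contained in the `δ`-neighbourhood of the union of the other two. -/
def DeltaHyperbolic (H : Type*) [MetricSpace H] (δ : ℝ) : Prop :=
  GeodesicSpace H ∧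
  ∀ x y z : H, ∀ γ₁ γ₂ γ₃ : ℝ → H,
    IsGeodSegment γ₁ x y → IsGeodSegment γ₂ y z → IsGeodSegment γ₃ z x →
    ∀ s ∈ Set.Icc (0:ℝ) (dist x y),
      ∃ u ∈ γ₂ '' Set.Icc (0:ℝ) (dist y z) ∪ γ₃ '' Set.Icc (0:ℝ) (dist z x),
        dist (γ₁ s) u ≤ δ

/-- A Busemann space: geodesic, and the distance between any two
arclength-parametrised geodesics is a convex function. -/
def BusemannSpace (H : Type*) [MetricSpace H] : Prop :=
  GeodesicSpace H ∧
  ∀ (a b a' b' : ℝ) (γ γ' : ℝ → H),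
    IsGeodesicOn γ (Set.Icc a b) → IsGeodesicOn γ' (Set.Icc a' b') →
    ConvexOn ℝ (Set.Icc a b ×ˢ Set.Icc a' b')
      (fun p : ℝ × ℝ => dist (γ p.1) (γ' p.2))

/-- Geodesic completeness: every geodesic segment extends to a geodesic line. -/
def GeodesicallyComplete (H : Type*) [MetricSpace H] : Prop :=
  ∀ (a b : ℝ) (γ : ℝ → H), a ≤ b → IsGeodesicOn γ (Set.Icc a b) →
    ∃ γ' : ℝ → H, IsGeodesicLine γ' ∧ ∀ t ∈ Set.Icc a b, γ' t = γ t

/-- The Busemann function with respect to the boundary point represented by the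
geodesic ray `aRep` and the base point `w`. -/
def busemann (w : H) (aRep : ℝ → H) (x : H) : ℝ :=
  sSup { b : ℝ | ∃ k : ℝ → H, IsRayFrom w k ∧ FinHausRays aRep k ∧
    b = Filter.limsup (fun t => dist x (k t) - t) Filter.atTop }

/-- The height function: minus the Busemann function. -/
def height (w : H) (aRep : ℝ → H) (x : H) : ℝ := - busemann w aRep x

/-- A vertical geodesic (forward oriented): a geodesic line whose height tends to `+∞`. -/
def IsVerticalGeodesic (w : H) (aRep : ℝ → H) (V : ℝ → H) : Prop :=
  IsGeodesicLine V ∧ Tendsto (fun t => height w aRep (V t)) atTop atTop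

/-- A vertical geodesic line (either orientation): a geodesic line whose image lies
in the boundary class, i.e. whose height tends to `+∞` along one of its ends. -/
def IsVerticalGeodesicLine (w : H) (aRep : ℝ → H) (V : ℝ → H) : Prop :=
  IsGeodesicLine V ∧
    (Tendsto (fun t => height w aRep (V t)) atTop atTop ∨
     Tendsto (fun t => height w aRep (V t)) atBot atTop)

/-- A vertical geodesic parametrised by its height: `h(V(t)) = t` for all `t`. -/
def VertParam (w : H) (aRep : ℝ → H) (V : ℝ → H) : Prop :=
  IsGeodesicLine V ∧ ∀ t : ℝ, height w aRep (V t) = t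

/-- Height difference `Δh(x,y)`. -/
def dh (w : H) (aRep : ℝ → H) (x y : H) : ℝ :=
  |height w aRep x - height w aRep y|

/-- Relative distance `d_r(x,y) = d(x,y) - Δh(x,y)`. -/
def dr (w : H) (aRep : ℝ → H) (x y : H) : ℝ := dist x y - dh w aRep x y

/-- Maximal height `h⁺` of a path along the parameter set `I`. -/
def hplusOn (w : H) (aRep : ℝ → H) (γ : ℝ → H) (I : Set ℝ) : ℝ :=
  sSup ((fun t => height w aRep (γ t)) '' I)

/-- Minimal height `h⁻` of a path along the parameter set `I`. -/
def hminusOn (w : H) (aRep : ℝ → H) (γ : ℝ → H) (I : Set ℝ) : ℝ :=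
  sInf ((fun t => height w aRep (γ t)) '' I)

/-- A path parametrised by arclength: the length of the piece on `[s,t]` equals `t - s`. -/
def ArclengthPath (V : ℝ → H) : Prop :=
  ∀ s t : ℝ, s ≤ t → eVariationOn V (Set.Icc s t) = ENNReal.ofReal (t - s)

/-- An admissible norm on `ℝ²`: a norm with `N(1,1) = 1` and `N(a,b) ≥ (a+b)/2`. -/
structure AdmNorm where
  toFun : ℝ × ℝ → ℝ
  eq_zero_iff : ∀ v : ℝ × ℝ, toFun v = 0 ↔ v = 0
  smul_eq : ∀ (c : ℝ) (v : ℝ × ℝ), toFun (c • v) = |c| * toFun v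
  add_le : ∀ v w : ℝ × ℝ, toFun (v + w) ≤ toFun v + toFun w
  one_one : toFun (1, 1) = 1
  adm : ∀ a b : ℝ, (a + b) / 2 ≤ toFun (a, b)

/-- `C` is a comparison constant `C_N` for the admissible norm `N`:
`C ≥ 1` and `N(a,b) ≤ C(a+b)/2` for all `a,b ≥ 0`. -/
def AdmNorm.BoundConst (N : AdmNorm) (C : ℝ) : Prop :=
  1 ≤ C ∧ ∀ a b : ℝ, 0 ≤ a → 0 ≤ b → N.toFun (a, b) ≤ C * (a + b) / 2

variable {Hp Hq : Type*} [MetricSpace Hp] [MetricSpace Hq]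

/-- Membership in the horospherical product: `h_p(x_p) + h_q(x_q) = 0`. -/
def inHoro (wp : Hp) (ap : ℝ → Hp) (wq : Hq) (aq : ℝ → Hq) (z : Hp × Hq) : Prop :=
  height wp ap z.1 + height wq aq z.2 = 0

/-- The `N`-length of a path in `Hp × Hq`: supremum over finite monotone
subdivisions of the sums of the `N(d_p, d_q)`-distances. -/
def lN (Nf : ℝ × ℝ → ℝ) (γ : ℝ → Hp × Hq) (s : Set ℝ) : ℝ≥0∞ :=
  ⨆ p : ℕ × { u : ℕ → ℝ // Monotone u ∧ ∀ i, u i ∈ s },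
    ∑ i ∈ Finset.range p.1,
      ENNReal.ofReal (Nf (dist (γ (p.2.1 (i+1))).1 (γ (p.2.1 i)).1,
                          dist (γ (p.2.1 (i+1))).2 (γ (p.2.1 i)).2))

/-- The `N`-path metric: infimum of `N`-lengths of connected paths staying in the
horospherical product and joining the two points. -/
def dHN (Nf : ℝ × ℝ → ℝ) (mem : Hp × Hq → Prop) (x y : Hp × Hq) : ℝ≥0∞ :=
  ⨅ (T : ℝ) (_ : 0 ≤ T) (γ : ℝ → Hp × Hq) (_ : ContinuousOn γ (Set.Icc 0 T))
    (_ : ∀ t ∈ Set.Icc (0:ℝ) T, mem (γ t)) (_ : γ 0 = x) (_ : γ T = y),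
    lN Nf γ (Set.Icc 0 T)

/-- A geodesic of the horospherical product with respect to the `N`-path metric,
parametrised (by arclength) on `I` and staying in the product. -/
def IsHNGeodesicOn (Nf : ℝ × ℝ → ℝ) (mem : Hp × Hq → Prop)
    (α : ℝ → Hp × Hq) (I : Set ℝ) : Prop :=
  (∀ t ∈ I, mem (α t)) ∧
  ∀ s ∈ I, ∀ t ∈ I, dHN Nf mem (α s) (α t) = ENNReal.ofReal |s - t|

/-- A vertical geodesic of the horospherical product, parametrised by its height. -/
def IsHNVerticalLine (Nf : ℝ × ℝ → ℝ) (mem : Hp × Hq → Prop)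
    (wp : Hp) (ap : ℝ → Hp) (V : ℝ → Hp × Hq) : Prop :=
  IsHNGeodesicOn Nf mem V Set.univ ∧ ∀ t : ℝ, height wp ap (V t).1 = t

/-- Maximal height `h⁺` of a path of the horospherical product. -/
def hplusH (wp : Hp) (ap : ℝ → Hp) (γ : ℝ → Hp × Hq) (I : Set ℝ) : ℝ :=
  sSup ((fun t => height wp ap (γ t).1) '' I)

/-- Minimal height `h⁻` of a path of the horospherical product. -/
def hminusH (wp : Hp) (ap : ℝ → Hp) (γ : ℝ → Hp × Hq) (I : Set ℝ) : ℝ :=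
  sInf ((fun t => height wp ap (γ t).1) '' I)

/-- `H_p`-type path at scale `κ`: the first component stays `κ`-close to a geodesic
of `H_p` and the second component stays `κ`-close to a vertical geodesic of `H_q`. -/
def IsHpType (wq : Hq) (aq : ℝ → Hq) (κ : ℝ) (α : ℝ → Hp × Hq) : Prop :=
  (∃ g : ℝ → Hp, IsGeodesicLine g ∧ ∀ t : ℝ, ∃ s : ℝ, dist (α t).1 (g s) ≤ κ) ∧
  (∃ v : ℝ → Hq, IsVerticalGeodesicLine wq aq v ∧ ∀ t : ℝ, ∃ s : ℝ, dist (α t).2 (v s) ≤ κ)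

/-- `H_q`-type path at scale `κ`. -/
def IsHqType (wp : Hp) (ap : ℝ → Hp) (κ : ℝ) (α : ℝ → Hp × Hq) : Prop :=
  (∃ g : ℝ → Hq, IsGeodesicLine g ∧ ∀ t : ℝ, ∃ s : ℝ, dist (α t).2 (g s) ≤ κ) ∧
  (∃ v : ℝ → Hp, IsVerticalGeodesicLine wp ap v ∧ ∀ t : ℝ, ∃ s : ℝ, dist (α t).1 (v s) ≤ κ)

/-- Finite Hausdorff distance on `[0,∞)` between two rays, for a generalized
(`ℝ≥0∞`-valued) distance `dd`. -/
def HNFinHaus {X : Type*} (dd : X → X → ℝ≥0∞) (α β : ℝ → X) : Prop :=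
  ∃ C : ℝ, (∀ s : ℝ, 0 ≤ s → ∃ t : ℝ, 0 ≤ t ∧ dd (α s) (β t) ≤ ENNReal.ofReal C) ∧
           (∀ t : ℝ, 0 ≤ t → ∃ s : ℝ, 0 ≤ s ∧ dd (α s) (β t) ≤ ENNReal.ofReal C)

theorem finHaus_equivalence (H : Type*) [MetricSpace H] :
    Equivalence (fun γ₁ γ₂ : {γ : ℝ → H // IsGeodesicRay γ} => FinHausRays γ₁.1 γ₂.1) := by
  constructor
  · intro γ
    exact ⟨0, fun s hs => ⟨s, hs, by simp⟩, fun t ht => ⟨t, ht, by simp⟩⟩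
  · rintro γ₁ γ₂ ⟨C, h1, h2⟩
    refine ⟨C, fun s hs => ?_, fun t ht => ?_⟩
    · obtain ⟨u, hu, hd⟩ := h2 s hs
      exact ⟨u, hu, by rwa [dist_comm]⟩
    · obtain ⟨u, hu, hd⟩ := h1 t ht
      exact ⟨u, hu, by rwa [dist_comm]⟩
  · rintro γ₁ γ₂ γ₃ ⟨C, h1, h2⟩ ⟨D, g1, g2⟩
    refine ⟨C + D, fun s hs => ?_, fun t ht => ?_⟩
    · obtain ⟨u, hu, hd⟩ := h1 s hs
      obtain ⟨v, hv, he⟩ := g1 u hu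
      exact ⟨v, hv, (dist_triangle _ (γ₂.1 u) _).trans (add_le_add hd he)⟩
    · obtain ⟨u, hu, hd⟩ := g2 t ht
      obtain ⟨v, hv, he⟩ := h2 u hu
      exact ⟨v, hv, (dist_triangle _ (γ₂.1 u) _).trans (add_le_add he hd)⟩

/-- The setoid of geodesic rays up to finite Hausdorff distance. -/
instance raySetoid (H : Type*) [MetricSpace H] : Setoid {γ : ℝ → H // IsGeodesicRay γ} :=
  ⟨fun γ₁ γ₂ => FinHausRays γ₁.1 γ₂.1, finHaus_equivalence H⟩

/-- The Gromov boundary: equivalence classes of geodesic rays at finite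
Hausdorff distance. -/
abbrev Bdry (H : Type*) [MetricSpace H] := Quotient (raySetoid H)

/-- The boundary point determined by a geodesic ray. -/
def bdryPt {H : Type*} [MetricSpace H] (γ : ℝ → H) (h : IsGeodesicRay γ) : Bdry H :=
  Quotient.mk (raySetoid H) ⟨γ, h⟩

/-- The set `((∂H_p ∖ {a_p}) × {a_q}) ∪ ({a_p} × (∂H_q ∖ {a_q}))`. -/
def bdryTarget {Hp Hq : Type*} [MetricSpace Hp] [MetricSpace Hq]
    (ap : ℝ → Hp) (hap : IsGeodesicRay ap)
    (aq : ℝ → Hq) (haq : IsGeodesicRay aq) : Set (Bdry Hp × Bdry Hq) :=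
  ((({bdryPt ap hap} : Set (Bdry Hp))ᶜ ×ˢ ({bdryPt aq haq} : Set (Bdry Hq))) ∪
   (({bdryPt ap hap} : Set (Bdry Hp)) ×ˢ ({bdryPt aq haq} : Set (Bdry Hq))ᶜ))

/-- The height at which the upward rays issued from `x` and `y` merge, up to a bounded error:
half of the sum of the heights and of the distance. -/
def merge {X : Type*} (f : X → ℝ) (d : X → X → ℝ) (x y : X) : ℝ := (f x + f y + d x y) / 2

/-- The data recorded by one factor along a path: the height `h t` and the distance `d s t`
between the points at times `s` and `t`. -/
structure Factor (δ : ℝ) (h : ℝ → ℝ) (d : ℝ → ℝ → ℝ) : Prop where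
  symm : ∀ s t, d s t = d t s
  self : ∀ s, d s s = 0
  lip : ∀ s t, |h s - h t| ≤ d s t
  le : ∀ s t, s ≤ t → d s t ≤ 2 * (t - s) - |h s - h t|
  four : ∀ s t u, merge h d s u ≤ max (merge h d s t) (merge h d t u) + 3 * δ

/-- The path stays above the level `M` on `[a,b]` and is at level `M` at both ends. -/
def Excursion (h : ℝ → ℝ) (M a b : ℝ) : Prop :=
  a ≤ b ∧ h a = M ∧ h b = M ∧ ∀ u ∈ Set.Icc a b, M ≤ h u

/-- The time spent on `[s,t]` exceeds the height variation by at most `R`. -/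
def Leg (h : ℝ → ℝ) (R s t : ℝ) : Prop := t - s ≤ |h s - h t| + R

/-- `[0,L]` is cut by `c₁ ≤ c₂` into three legs of excess at most `R`. -/
structure ThreeLegs (h : ℝ → ℝ) (R L c₁ c₂ : ℝ) : Prop where
  nonneg : 0 ≤ c₁
  le : c₁ ≤ c₂
  le_end : c₂ ≤ L
  leg₁ : Leg h R 0 c₁
  leg₂ : Leg h R c₁ c₂
  leg₃ : Leg h R c₂ L

lemma merge_eq_max_add {X : Type*} (f : X → ℝ) (d : X → X → ℝ) (x y : X) :
    merge f d x y = max (f x) (f y) + (d x y - |f x - f y|) / 2 := by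
  unfold merge
  rcases le_total (f x) (f y) with h | h
  · rw [max_eq_right h, abs_of_nonpos (by linarith)]; ring
  · rw [max_eq_left h, abs_of_nonneg (by linarith)]; ring

lemma exists_first_le {h : ℝ → ℝ} (hc : Continuous h) {τ t M : ℝ} (hτ : τ ≤ t) (ht : h t ≤ M) :
    ∃ u, τ ≤ u ∧ u ≤ t ∧ h u ≤ M ∧ ∀ v, τ ≤ v → v < u → M < h v := by
  have hK : IsCompact (Set.Icc τ t ∩ {u | h u ≤ M}) :=
    isCompact_Icc.inter_right (isClosed_le hc continuous_const)
  obtain ⟨u, ⟨⟨⟨h1, h2⟩, h3⟩, h4⟩⟩ := hK.exists_isLeast ⟨t, ⟨hτ, le_rfl⟩, ht⟩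
  refine ⟨u, h1, h2, h3, fun v hv hvu => ?_⟩
  by_contra! hle
  exact absurd (h4 ⟨⟨hv, hvu.le.trans h2⟩, hle⟩) (not_le.2 hvu)

lemma exists_last_le {h : ℝ → ℝ} (hc : Continuous h) {s τ M : ℝ} (hτ : s ≤ τ) (hs : h s ≤ M) :
    ∃ u, s ≤ u ∧ u ≤ τ ∧ h u ≤ M ∧ ∀ v, u < v → v ≤ τ → M < h v := by
  have hK : IsCompact (Set.Icc s τ ∩ {u | h u ≤ M}) :=
    isCompact_Icc.inter_right (isClosed_le hc continuous_const)
  obtain ⟨u, ⟨⟨⟨h1, h2⟩, h3⟩, h4⟩⟩ := hK.exists_isGreatest ⟨s, ⟨le_rfl, hτ⟩, hs⟩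
  refine ⟨u, h1, h2, h3, fun v hv hvu => ?_⟩
  by_contra! hle
  exact absurd (h4 ⟨⟨h1.trans hv.le, hvu⟩, hle⟩) (not_le.2 hv)

lemma eq_or_excursion {h : ℝ → ℝ} (hc : Continuous h) {a b M : ℝ} (hab : a ≤ b) (ha : h a ≤ M)
    (hb : h b ≤ M) (hM : ∀ v, a < v → v < b → M < h v) : a = b ∨ Excursion h M a b := by
  rcases hab.eq_or_lt with h0 | h0
  · exact Or.inl h0
  · have hsub : Set.Icc a b ⊆ {v | M ≤ h v} := by
      rw [← closure_Ioo h0.ne]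
      exact closure_minimal (fun v hv => (hM v hv.1 hv.2).le) (isClosed_le continuous_const hc)
    exact Or.inr ⟨hab, le_antisymm ha (hsub (Set.left_mem_Icc.2 hab)),
      le_antisymm hb (hsub (Set.right_mem_Icc.2 hab)), hsub⟩

/-- The maximal interval around `c` on which the path is above the level `M`. -/
lemma exists_interval_above {h : ℝ → ℝ} (hc : Continuous h) {s t c M : ℝ} (hs : h s ≤ M)
    (ht : h t ≤ M) (hsc : s ≤ c) (hct : c ≤ t) :
    ∃ a b, s ≤ a ∧ a ≤ c ∧ c ≤ b ∧ b ≤ t ∧ h a ≤ M ∧ h b ≤ M ∧ (a = b ∨ Excursion h M a b) := by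
  obtain ⟨a, a1, a2, a3, a4⟩ := exists_last_le hc hsc hs
  obtain ⟨b, b1, b2, b3, b4⟩ := exists_first_le hc hct ht
  refine ⟨a, b, a1, a2, b1, b2, a3, b3, eq_or_excursion hc (a2.trans b1) a3 b3 fun v h1 h2 => ?_⟩
  rcases le_total v c with h | h
  · exact a4 v h1 h
  · exact b4 v h h2

lemma Excursion.merge_eq {h : ℝ → ℝ} {d : ℝ → ℝ → ℝ} {M a b : ℝ} (he : Excursion h M a b) :
    d a b = 2 * (merge h d a b - M) := by
  rw [merge, he.2.1, he.2.2.1]; ring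

namespace Factor

variable {δ : ℝ} {h : ℝ → ℝ} {d : ℝ → ℝ → ℝ}

lemma merge_comm (F : Factor δ h d) (s t : ℝ) : merge h d s t = merge h d t s := by
  simp only [merge, F.symm s t]; ring

lemma merge_self (F : Factor δ h d) (s : ℝ) : merge h d s s = h s := by
  simp only [merge, F.self s]; ring

lemma abs_sub_le (F : Factor δ h d) (s t : ℝ) : |h s - h t| ≤ |s - t| := by
  wlog hst : s ≤ t generalizing s t
  · rw [abs_sub_comm, abs_sub_comm s]; exact this t s (le_of_not_ge hst)
  have h1 := F.lip s t
  have h2 := F.le s t hst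
  rw [abs_sub_comm s, abs_of_nonneg (sub_nonneg.2 hst)]
  linarith

lemma continuous (F : Factor δ h d) : Continuous h := by
  refine LipschitzWith.continuous (K := 1) (LipschitzWith.of_dist_le_mul fun s t => ?_)
  simpa [Real.dist_eq] using F.abs_sub_le s t

lemma leg_mono (F : Factor δ h d) {R s a b t : ℝ} (hl : Leg h R s t) (hsa : s ≤ a)
    (hbt : b ≤ t) : Leg h R a b := by
  have h1 := F.abs_sub_le s a
  have h2 := F.abs_sub_le b t
  rw [abs_sub_comm s, abs_of_nonneg (sub_nonneg.2 hsa)] at h1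
  rw [abs_sub_comm b, abs_of_nonneg (sub_nonneg.2 hbt)] at h2
  have h3 : |h s - h t| ≤ |h s - h a| + |h a - h b| + |h b - h t| := by
    have := _root_.abs_sub_le (h s) (h a) (h t)
    have := _root_.abs_sub_le (h a) (h b) (h t)
    linarith
  unfold Leg at *
  linarith

lemma chain (F : Factor δ h d) {B : ℝ} {τ : ℕ → ℝ}
    (hB : ∀ i, merge h d (τ i) (τ (i + 1)) ≤ B) (k : ℕ) :
    ∀ i, merge h d (τ i) (τ (i + 2 ^ k)) ≤ B + 3 * k * δ := by
  induction k with
  | zero => intro i; simpa using hB i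
  | succ k ih =>
    intro i
    have h1 := F.four (τ i) (τ (i + 2 ^ k)) (τ (i + 2 ^ k + 2 ^ k))
    have h2 := max_le (ih i) (ih (i + 2 ^ k))
    have h3 : i + 2 ^ (k + 1) = i + 2 ^ k + 2 ^ k := by rw [pow_succ]; ring
    rw [h3]
    push_cast
    linarith

lemma merge_le_of_short (F : Factor δ h d) (hδ : 0 ≤ δ) {s t M B : ℝ} {k : ℕ} (hst : s ≤ t)
    (hlen : t - s ≤ δ * 2 ^ k) (hs : h s ≤ M) (ht : h t ≤ M) (hMB : M ≤ B)
    (hexc : ∀ a b, s ≤ a → b ≤ t → Excursion h M a b → merge h d a b ≤ B) :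
    merge h d s t ≤ B + (3 * k + 4) * δ := by
  have hpow : (0 : ℝ) < 2 ^ k := by positivity
  set η : ℝ := (t - s) / 2 ^ k with hη
  have hη0 : 0 ≤ η := div_nonneg (sub_nonneg.2 hst) hpow.le
  have hηδ : η ≤ δ := by rw [hη, div_le_iff₀ hpow]; exact hlen
  set g : ℕ → ℝ := fun j => min (s + j * η) t with hg
  have hgs : ∀ j, s ≤ g j := fun j => le_min (by nlinarith [Nat.cast_nonneg (α := ℝ) j]) hst
  have hgt : ∀ j, g j ≤ t := fun j => min_le_right _ _
  have hstep : ∀ j, g (j + 1) ≤ g j + δ := by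
    intro j
    simp only [hg]
    push_cast
    rcases le_total (s + j * η) t with h1 | h1
    · rw [min_eq_left h1]
      exact (min_le_left _ _).trans (by linarith)
    · rw [min_eq_right h1]
      exact (min_le_right _ _).trans (by linarith)
  choose u hu1 hu2 hu3 hu4 using fun j => exists_first_le F.continuous (hgt j) ht
  have hg0 : g 0 = s := by simp [hg, hst]
  have hgk : g (2 ^ k) = t := by
    simp only [hg]
    push_cast
    rw [hη, mul_div_cancel₀ _ hpow.ne']
    simp
  have hu0 : u 0 = s := by
    refine le_antisymm (not_lt.1 fun hlt => ?_) (hg0 ▸ hu1 0)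
    exact absurd (hu4 0 s hg0.le hlt) (not_lt.2 hs)
  have huk : u (2 ^ k) = t := le_antisymm (hu2 _) (hgk ▸ hu1 (2 ^ k))
  have key : ∀ j, merge h d (u j) (u (j + 1)) ≤ B + 4 * δ := by
    intro j
    rcases le_or_gt (g (j + 1)) (u j) with hc | hc
    · have h1 : u (j + 1) ≤ u j := not_lt.1 fun hlt => absurd (hu4 _ _ hc hlt) (not_lt.2 (hu3 j))
      have h2 : u j ≤ u (j + 1) := by
        refine not_lt.1 fun hlt => absurd (hu4 j _ ?_ hlt) (not_lt.2 (hu3 _))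
        refine le_trans ?_ (hu1 (j + 1))
        simp only [hg]
        push_cast
        exact min_le_min (by linarith) le_rfl
      rw [le_antisymm h1 h2, F.merge_self]
      linarith [hu3 j]
    · obtain ⟨c, c1, c2, c3, c4⟩ := exists_last_le F.continuous hc.le (hu3 j)
      have hcb : c ≤ u (j + 1) := c2.trans (hu1 _)
      have h1 : merge h d (u j) c ≤ M + δ := by
        have h2 := F.le (u j) c c1
        have h3 := hu3 j
        have h4 := hstep j
        have h5 := hu1 j
        have h6 := abs_nonneg (h (u j) - h c)
        unfold merge
        linarith
      have h2 : merge h d c (u (j + 1)) ≤ B := by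
        have above : ∀ v, c < v → v < u (j + 1) → M < h v := fun v h1 h2 =>
          (le_total v (g (j + 1))).elim (c4 v h1) fun h3 => hu4 _ v h3 h2
        rcases eq_or_excursion F.continuous hcb c3 (hu3 _) above with h0 | h0
        · rw [← h0, F.merge_self]; exact c3.trans hMB
        · exact hexc _ _ (((hgs j).trans (hu1 j)).trans c1) (hu2 _) h0
      have h3 := F.four (u j) c (u (j + 1))
      have h4 : max (merge h d (u j) c) (merge h d c (u (j + 1))) ≤ B + δ :=
        max_le (by linarith) (by linarith)
      linarith
  have := F.chain key k 0
  rw [zero_add, hu0, huk] at this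
  linarith

lemma merge_le_of_deep (F : Factor δ h d) {s t M R : ℝ} (hst : s ≤ t) (hl : Leg h R s t)
    (hs : h s ≤ M - R) (ht : h t ≤ M - R) : merge h d s t ≤ M := by
  have h1 := F.le s t hst
  unfold Leg at hl
  unfold merge
  rcases abs_cases (h s - h t) with h2 | h2 <;> linarith

lemma merge_le_of_leg (F : Factor δ h d) (hδ : 0 ≤ δ) {s t M B R : ℝ} {k : ℕ} (hst : s ≤ t)
    (hR : 2 * R ≤ δ * 2 ^ k) (hl : Leg h R s t) (hs : h s ≤ M) (ht : h t ≤ M) (hMB : M ≤ B)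
    (hexc : ∀ a b, s ≤ a → b ≤ t → Excursion h M a b → merge h d a b ≤ B) :
    merge h d s t ≤ B + (3 * k + 7) * δ := by
  have hk : 0 ≤ (k : ℝ) * δ := by positivity
  have hR0 : 0 ≤ R := by
    have := F.abs_sub_le s t
    rw [abs_sub_comm s, abs_of_nonneg (sub_nonneg.2 hst)] at this
    unfold Leg at hl
    linarith
  have short : ∀ a b, s ≤ a → a ≤ b → b ≤ t → h a ≤ M → h b ≤ M → M - R ≤ h a → M - R ≤ h b →
      merge h d a b ≤ B + (3 * k + 4) * δ := by
    intro a b hsa hab hbt ha hb ha' hb'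
    refine F.merge_le_of_short hδ hab ?_ ha hb hMB
      fun a' b' h1 h2 => hexc a' b' (hsa.trans h1) (h2.trans hbt)
    have h1 := F.leg_mono hl hsa hbt
    have h2 : |h a - h b| ≤ R := abs_le.2 ⟨by linarith, by linarith⟩
    unfold Leg at h1
    linarith
  have cut : ∀ u, s ≤ u → u ≤ t → merge h d s u ≤ B + (3 * k + 4) * δ →
      merge h d u t ≤ B + (3 * k + 4) * δ → merge h d s t ≤ B + (3 * k + 7) * δ := by
    intro u _ _ h1 h2
    have := F.four s u t
    have := max_le h1 h2
    linarith
  rcases le_or_gt (M - R) (h s) with h1 | h1 <;> rcases le_or_gt (M - R) (h t) with h2 | h2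
  · linarith [short s t le_rfl hst le_rfl hs ht h1 h2]
  · obtain ⟨u, hu, hu'⟩ := intermediate_value_Icc' hst F.continuous.continuousOn ⟨h2.le, h1⟩
    have hd := F.merge_le_of_deep (M := M) hu.2 (F.leg_mono hl hu.1 le_rfl) hu'.le h2.le
    exact cut u hu.1 hu.2 (short s u le_rfl hu.1 hu.2 hs (by linarith) h1 hu'.ge) (by linarith)
  · obtain ⟨u, hu, hu'⟩ := intermediate_value_Icc hst F.continuous.continuousOn ⟨h1.le, h2⟩
    have hd := F.merge_le_of_deep (M := M) hu.1 (F.leg_mono hl le_rfl hu.2) h1.le hu'.le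
    exact cut u hu.1 hu.2 (by linarith) (short u t hu.1 hu.2 le_rfl (by linarith) ht hu'.ge h2)
  · linarith [F.merge_le_of_deep (M := M) hst hl h1.le h2.le]

lemma merge_le_of_threeLegs (F : Factor δ h d) (hδ : 0 ≤ δ) {L R c₁ c₂ a b M B : ℝ} {k : ℕ}
    (T : ThreeLegs h R L c₁ c₂) (hR : 2 * R ≤ δ * 2 ^ k) (ha0 : 0 ≤ a) (hab : a ≤ b) (hbL : b ≤ L)
    (ha : h a ≤ M) (hb : h b ≤ M) (hc₁ : a ≤ c₁ → c₁ ≤ b → h c₁ ≤ M)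
    (hc₂ : a ≤ c₂ → c₂ ≤ b → h c₂ ≤ M) (hMB : M ≤ B)
    (hexc : ∀ a' b', a ≤ a' → b' ≤ b → Excursion h M a' b' → merge h d a' b' ≤ B) :
    merge h d a b ≤ B + (3 * k + 13) * δ := by
  have hk : 0 ≤ (k : ℝ) * δ := by positivity
  have leg : ∀ s t, a ≤ s → s ≤ t → t ≤ b → Leg h R s t → h s ≤ M → h t ≤ M →
      merge h d s t ≤ B + (3 * k + 7) * δ := fun s t h1 h2 h3 h4 h5 h6 =>
    F.merge_le_of_leg hδ h2 hR h4 h5 h6 hMB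
      fun a' b' h7 h8 => hexc a' b' (h1.trans h7) (h8.trans h3)
  have join : ∀ s t u C, merge h d s t ≤ C → merge h d t u ≤ C → merge h d s u ≤ C + 3 * δ :=
    fun s t u C h1 h2 => (F.four s t u).trans (by linarith [max_le h1 h2])
  have T1 := T.leg₁
  have T2 := T.leg₂
  have T3 := T.leg₃
  -- the part of `[a,b]` before `c₂`
  have before : ∀ b', a ≤ b' → b' ≤ b → b' ≤ c₂ → h b' ≤ M →
      merge h d a b' ≤ B + (3 * k + 10) * δ := by
    intro b' h1 h2 h3 h4
    rcases le_or_gt c₁ a with h5 | h5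
    · linarith [leg a b' le_rfl h1 h2 (F.leg_mono T2 h5 h3) ha h4]
    rcases le_or_gt b' c₁ with h6 | h6
    · linarith [leg a b' le_rfl h1 h2 (F.leg_mono T1 ha0 h6) ha h4]
    have h7 := hc₁ h5.le (h6.le.trans h2)
    have := join a c₁ b' _ (leg a c₁ le_rfl h5.le (h6.le.trans h2) (F.leg_mono T1 ha0 le_rfl) ha h7)
      (leg c₁ b' h5.le h6.le h2 (F.leg_mono T2 le_rfl h3) h7 h4)
    linarith
  rcases le_or_gt b c₂ with h5 | h5
  · linarith [before b hab le_rfl h5 hb]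
  rcases le_or_gt c₂ a with h6 | h6
  · linarith [leg a b le_rfl hab le_rfl (F.leg_mono T3 h6 hbL) ha hb]
  have h7 := hc₂ h6.le h5.le
  have := join a c₂ b (B + (3 * k + 10) * δ) (before c₂ h6.le h5.le le_rfl h7)
    (by linarith [leg c₂ b h6.le h5.le le_rfl (F.leg_mono T3 le_rfl hbL) h7 hb])
  linarith

lemma merge_le_of_le (F : Factor δ h d) (hδ : 0 < δ) {L R c₁ c₂ a b M : ℝ} {k : ℕ}
    (T : ThreeLegs h R L c₁ c₂) (hR : 2 * R ≤ δ * 2 ^ k) (ha0 : 0 ≤ a) (hab : a ≤ b) (hbL : b ≤ L)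
    (hM : ∀ u, a ≤ u → u ≤ b → h u ≤ M) : merge h d a b ≤ M + (3 * k + 14) * δ := by
  have h1 := F.merge_le_of_threeLegs hδ.le (M := M + δ) (B := M + δ) T hR ha0 hab hbL
    (by linarith [hM a le_rfl hab]) (by linarith [hM b hab le_rfl])
    (fun h1 h2 => by linarith [hM _ h1 h2]) (fun h1 h2 => by linarith [hM _ h1 h2]) le_rfl
    (fun a' b' h1 h2 h3 => by linarith [hM a' h1 (h3.1.trans h2), h3.2.1])
  linarith

end Factor

/-- The data recorded along a path of length `L` of the horospherical product by its height and the
distances `dp`, `dq` between its components. Here `κp = N(1,0)` and `κq = N(0,1)`. -/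
structure HoroPath (δ κ κp κq μp μq L : ℝ) (h : ℝ → ℝ) (dp dq : ℝ → ℝ → ℝ) : Prop where
  P : Factor δ h dp
  Q : Factor δ (fun t => - h t) dq
  δ_pos : 0 < δ
  κ_eq : κp + κq = κ
  one_le : 1 ≤ κ
  κ_le_p : κ ≤ 4 * κp
  κ_le_q : κ ≤ 4 * κq
  μp_eq : μp = max 0 (κp - 1)
  μq_eq : μq = max 0 (κq - 1)
  dp_le : ∀ s t, s ≤ t → κp * dp s t ≤ t - s + κq * dq s t
  dq_le : ∀ s t, s ≤ t → κq * dq s t ≤ t - s + κp * dp s t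
  upper : ∀ s t, 0 ≤ s → s ≤ t → t ≤ L →
    t - s ≤ |h s - h t| + (1 + 2 * μp) * (dp s t - |h s - h t|)
      + (1 + 2 * μq) * (dq s t - |h s - h t|) + 24 * κ * δ

/-- A `HoroPath` cut at a highest and at a lowest point into three legs of excess at most `R`,
where `R` is controlled by the scale `k`, with its error term `ρ`. -/
structure CutPath (δ κ κp κq μp μq L : ℝ) (h : ℝ → ℝ) (dp dq : ℝ → ℝ → ℝ) (k : ℕ)
    (R ρ t₀ t₁ : ℝ) : Prop extends HoroPath δ κ κp κq μp μq L h dp dq where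
  ρ_eq : ρ = (3 * k + 14) * δ
  R_le : 2 * R ≤ δ * 2 ^ k
  le_R : 14 * κ * ρ ≤ R
  mem₀ : t₀ ∈ Set.Icc 0 L
  mem₁ : t₁ ∈ Set.Icc 0 L
  le_max : ∀ u ∈ Set.Icc 0 L, h u ≤ h t₀
  min_le : ∀ u ∈ Set.Icc 0 L, h t₁ ≤ h u
  legs : ThreeLegs h R L (min t₀ t₁) (max t₀ t₁)

lemma Leg.neg {h : ℝ → ℝ} {R s t : ℝ} (hl : Leg h R s t) : Leg (fun t => - h t) R s t := by
  have h1 : - h s - - h t = -(h s - h t) := by ring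
  simpa only [Leg, h1, abs_neg] using hl

lemma ThreeLegs.neg {h : ℝ → ℝ} {R L c₁ c₂ : ℝ} (T : ThreeLegs h R L c₁ c₂) :
    ThreeLegs (fun t => - h t) R L c₁ c₂ :=
  ⟨T.nonneg, T.le, T.le_end, T.leg₁.neg, T.leg₂.neg, T.leg₃.neg⟩

namespace HoroPath

variable {δ κ κp κq μp μq L : ℝ} {h : ℝ → ℝ} {dp dq : ℝ → ℝ → ℝ}

lemma swap (C : HoroPath δ κ κp κq μp μq L h dp dq) :
    HoroPath δ κ κq κp μq μp L (fun t => - h t) dq dp where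
  P := C.Q
  Q := by simpa using C.P
  δ_pos := C.δ_pos
  κ_eq := by linarith [C.κ_eq]
  one_le := C.one_le
  κ_le_p := C.κ_le_q
  κ_le_q := C.κ_le_p
  μp_eq := C.μq_eq
  μq_eq := C.μp_eq
  dp_le := C.dq_le
  dq_le := C.dp_le
  upper := fun s t h1 h2 h3 => by
    have h4 : - h s - - h t = -(h s - h t) := by ring
    simp only [h4, abs_neg]
    linarith [C.upper s t h1 h2 h3]

lemma μp_nonneg (C : HoroPath δ κ κp κq μp μq L h dp dq) : 0 ≤ μp :=
  C.μp_eq ▸ le_max_left _ _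

lemma μp_le (C : HoroPath δ κ κp κq μp μq L h dp dq) : μp ≤ κ := by
  rw [C.μp_eq]
  exact max_le (by linarith [C.one_le]) (by linarith [C.κ_eq, C.κ_le_q, C.one_le])

lemma rel_nonneg (C : HoroPath δ κ κp κq μp μq L h dp dq) (s t : ℝ) :
    0 ≤ dp s t - |h s - h t| := sub_nonneg.2 (C.P.lip s t)

lemma coarse (C : HoroPath δ κ κp κq μp μq L h dp dq) {s t : ℝ} (hs : 0 ≤ s) (hst : s ≤ t)
    (ht : t ≤ L) : t - s ≤ |h s - h t| + 3 * κ * (dp s t - |h s - h t|)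
      + 3 * κ * (dq s t - |h s - h t|) + 24 * κ * δ := by
  have h1 := C.upper s t hs hst ht
  have hq := C.swap.rel_nonneg s t
  have h4 : - h s - - h t = -(h s - h t) := by ring
  simp only [h4, abs_neg] at hq
  have h2 := mul_le_mul_of_nonneg_right
    (show 1 + 2 * μp ≤ 3 * κ by linarith [C.μp_le, C.one_le]) (C.rel_nonneg s t)
  have h3 := mul_le_mul_of_nonneg_right
    (show 1 + 2 * μq ≤ 3 * κ by linarith [C.swap.μp_le, C.one_le]) hq
  linarith

end HoroPath

namespace CutPath

variable {δ κ κp κq μp μq L : ℝ} {h : ℝ → ℝ} {dp dq : ℝ → ℝ → ℝ} {k : ℕ} {R ρ t₀ t₁ : ℝ}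

lemma swap (S : CutPath δ κ κp κq μp μq L h dp dq k R ρ t₀ t₁) :
    CutPath δ κ κq κp μq μp L (fun t => - h t) dq dp k R ρ t₁ t₀ where
  toHoroPath := S.toHoroPath.swap
  ρ_eq := S.ρ_eq
  R_le := S.R_le
  le_R := S.le_R
  mem₀ := S.mem₁
  mem₁ := S.mem₀
  le_max := fun u hu => neg_le_neg (S.min_le u hu)
  min_le := fun u hu => neg_le_neg (S.le_max u hu)
  legs := by rw [min_comm, max_comm]; exact S.legs.neg

lemma δ_le (S : CutPath δ κ κp κq μp μq L h dp dq k R ρ t₀ t₁) : 14 * δ ≤ ρ := by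
  rw [S.ρ_eq]
  nlinarith [mul_nonneg (Nat.cast_nonneg (α := ℝ) k) S.δ_pos.le]

lemma ρ_pos (S : CutPath δ κ κp κq μp μq L h dp dq k R ρ t₀ t₁) : 0 < ρ := by
  linarith [S.δ_le, S.δ_pos]

lemma ρ_le (S : CutPath δ κ κp κq μp μq L h dp dq k R ρ t₀ t₁) : ρ ≤ κ * ρ :=
  le_mul_of_one_le_left S.ρ_pos.le S.one_le

lemma κδ_le (S : CutPath δ κ κp κq μp μq L h dp dq k R ρ t₀ t₁) : 14 * (κ * δ) ≤ κ * ρ := by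
  have := mul_le_mul_of_nonneg_left S.δ_le (by linarith [S.one_le] : (0 : ℝ) ≤ κ)
  linarith

lemma merge_le (S : CutPath δ κ κp κq μp μq L h dp dq k R ρ t₀ t₁) {a b M : ℝ} (ha : 0 ≤ a)
    (hab : a ≤ b) (hb : b ≤ L) (hM : ∀ u, a ≤ u → u ≤ b → h u ≤ M) : merge h dp a b ≤ M + ρ := by
  rw [S.ρ_eq]
  exact S.P.merge_le_of_le S.δ_pos S.legs S.R_le ha hab hb hM

lemma dq_le_of_excursion (S : CutPath δ κ κp κq μp μq L h dp dq k R ρ t₀ t₁) {a b M : ℝ}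
    (ha : 0 ≤ a) (hb : b ≤ L) (he : Excursion h M a b) : dq a b ≤ 2 * ρ := by
  have h1 := S.swap.merge_le ha he.1 hb (M := - M) fun u h1 h2 => neg_le_neg (he.2.2.2 u ⟨h1, h2⟩)
  rw [merge, he.2.1, he.2.2.1] at h1
  linarith

lemma dp_le_of_le (S : CutPath δ κ κp κq μp μq L h dp dq k R ρ t₀ t₁) {a b : ℝ}
    (ha : 0 ≤ a) (hab : a ≤ b) (hb : b ≤ L) (hM : ∀ u, a ≤ u → u ≤ b → h u ≤ max (h a) (h b)) :
    dp a b - |h a - h b| ≤ 2 * ρ := by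
  have h1 := S.merge_le ha hab hb hM
  rw [merge_eq_max_add] at h1
  linarith

/-- A piece of the path whose height stays between those of its end points has small excess. -/
lemma leg_of_between (S : CutPath δ κ κp κq μp μq L h dp dq k R ρ t₀ t₁) {a b : ℝ}
    (ha : 0 ≤ a) (hab : a ≤ b) (hb : b ≤ L) (hM : ∀ u, a ≤ u → u ≤ b → h u ≤ max (h a) (h b))
    (hm : ∀ u, a ≤ u → u ≤ b → min (h a) (h b) ≤ h u) : Leg h (14 * κ * ρ) a b := by
  have h1 := S.dp_le_of_le ha hab hb hM
  have h2 := S.swap.dp_le_of_le ha hab hb fun u h1 h2 => by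
    simpa only [max_neg_neg] using neg_le_neg (hm u h1 h2)
  have h4 : - h a - - h b = -(h a - h b) := by ring
  simp only [h4, abs_neg] at h2
  have h3 := S.coarse ha hab hb
  have h5 := S.one_le
  have h6 := mul_le_mul_of_nonneg_left h1 (by linarith : (0 : ℝ) ≤ κ)
  have h7 := mul_le_mul_of_nonneg_left h2 (by linarith : (0 : ℝ) ≤ κ)
  have h8 := S.κδ_le
  have h9 := mul_nonneg (by linarith : (0 : ℝ) ≤ κ) S.ρ_pos.le
  unfold Leg
  linarith

lemma Excursion.leg_up (S : CutPath δ κ κp κq μp μq L h dp dq k R ρ t₀ t₁) {v a b c : ℝ}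
    (ha : 0 ≤ a) (hb : b ≤ L) (he : Excursion h v a b) (hc : c ∈ Set.Icc a b)
    (hmax : ∀ u ∈ Set.Icc a b, h u ≤ h c) : Leg h (14 * κ * ρ) a c :=
  S.leg_of_between ha hc.1 (hc.2.trans hb)
    (fun u h1 h2 => le_max_of_le_right (hmax u ⟨h1, h2.trans hc.2⟩))
    fun u h1 h2 => min_le_of_left_le (he.2.1 ▸ he.2.2.2 u ⟨h1, h2.trans hc.2⟩)

lemma Excursion.leg_down (S : CutPath δ κ κp κq μp μq L h dp dq k R ρ t₀ t₁) {v a b c : ℝ}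
    (ha : 0 ≤ a) (hb : b ≤ L) (he : Excursion h v a b) (hc : c ∈ Set.Icc a b)
    (hmax : ∀ u ∈ Set.Icc a b, h u ≤ h c) : Leg h (14 * κ * ρ) c b :=
  S.leg_of_between (ha.trans hc.1) hc.2 hb
    (fun u h1 h2 => le_max_of_le_left (hmax u ⟨hc.1.trans h1, h2⟩))
    fun u h1 h2 => min_le_of_right_le (he.2.2.1 ▸ he.2.2.2 u ⟨hc.1.trans h1, h2⟩)

/-- A leg of small excess that stays low contains no wide excursion, so its ends merge low. -/
lemma merge_lt_of_leg (S : CutPath δ κ κp κq μp μq L h dp dq k R ρ t₀ t₁) {a b M w : ℝ}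
    (ha : 0 ≤ a) (hab : a ≤ b) (hb : b ≤ L) (hl : Leg h (14 * κ * ρ) a b) (hMa : h a ≤ M)
    (hMb : h b ≤ M) (hw : 36 * (κ * ρ) < κ * w) : merge h dp a b < M + w - 6 * δ := by
  have hκ := S.one_le
  have hρ := S.ρ_pos
  have hw' : ρ < w := by nlinarith
  have h1 := S.P.merge_le_of_leg S.δ_pos.le (M := M) (B := M + w - ρ) (k := k) hab
    (by linarith [S.R_le, S.le_R]) hl hMa hMb (by linarith) fun a' b' h1 h2 he => by
      by_contra! h3
      have h4 := he.merge_eq (d := dp)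
      have h5 := S.dq_le_of_excursion (ha.trans h1) (h2.trans hb) he
      have h6 := S.P.leg_mono hl h1 h2
      have h7 := S.dp_le a' b' he.1
      rw [Leg, he.2.1, he.2.2.1, sub_self, abs_zero] at h6
      have h8 : dp a' b' ≥ 2 * w - 2 * ρ := by linarith
      have hp : 0 ≤ κp := by linarith [S.κ_le_p]
      have h9 := mul_le_mul_of_nonneg_left h8 hp
      have h10 := mul_le_mul_of_nonneg_left h5 (by linarith [S.κ_le_q] : 0 ≤ κq)
      have h11 : (κp + κq) * ρ = κ * ρ := by rw [S.κ_eq]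
      have h12 := mul_le_mul_of_nonneg_right S.κ_le_p (by linarith : 0 ≤ w)
      linarith [S.ρ_le]
  rw [S.ρ_eq] at h1
  have := S.δ_pos
  linarith

/-- An excursion does not rise much above the height at which its end points merge. -/
lemma overshoot (S : CutPath δ κ κp κq μp μq L h dp dq k R ρ t₀ t₁) {v a b c : ℝ}
    (ha : 0 ≤ a) (hb : b ≤ L) (he : Excursion h v a b) (hc : c ∈ Set.Icc a b)
    (hmax : ∀ u ∈ Set.Icc a b, h u ≤ h c) : h c ≤ merge h dp a b + 112 * (κ * ρ) := by
  have hκ := S.one_le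
  have hρ := S.ρ_pos
  have hκρ := S.ρ_le
  have hab := (abs_nonneg _).trans (S.P.lip a b)
  have hm := he.merge_eq (d := dp)
  set m := merge h dp a b with hm_def
  obtain ⟨s, t, as, sc, ct, tb, hs, ht, hst⟩ :=
    exists_interval_above S.P.continuous (M := m) (by linarith [he.2.1] : h a ≤ m)
      (by linarith [he.2.2.1] : h b ≤ m) hc.1 hc.2
  rcases hst with hst | hst
  · have : c = t := le_antisymm ct (hst ▸ sc)
    rw [this]; linarith
  set w := merge h dp s t - m with hw_def
  have hw : κ * w ≤ 36 * (κ * ρ) := by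
    by_contra! hlt
    have h1 := S.merge_lt_of_leg (ha) as ((sc.trans hc.2).trans hb)
      (S.P.leg_mono (Excursion.leg_up S ha hb he hc hmax) le_rfl sc) (by linarith [he.2.1]) hs hlt
    have h2 := S.merge_lt_of_leg ((ha.trans hc.1).trans ct) tb hb
      (S.P.leg_mono (Excursion.leg_down S ha hb he hc hmax) ct le_rfl) ht (by linarith [he.2.2.1])
      hlt
    have h3 := S.P.four s a t
    have h4 := S.P.four a b t
    rw [S.P.merge_comm s a] at h3
    rw [S.P.merge_comm b t, ← hm_def] at h4
    have h5 : 6 * δ < w := by nlinarith [S.δ_le]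
    have h6 : max m (merge h dp t b) < m + w - 6 * δ ∨ max m (merge h dp t b) = m :=
      (max_choice m (merge h dp t b)).elim Or.inr fun h => Or.inl (by rwa [h])
    rcases max_choice (merge h dp a s) (merge h dp a t) with h7 | h7 <;> rw [h7] at h3 <;>
      rcases h6 with h6 | h6 <;> linarith [S.δ_pos]
  have h1 := hst.merge_eq (d := dp)
  have h2 := S.dq_le_of_excursion (ha.trans as) (tb.trans hb) hst
  have h3 := S.coarse (ha.trans as) hst.1 (tb.trans hb)
  have h4 := S.P.abs_sub_le s c
  have h5 := S.P.abs_sub_le c t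
  rw [hst.2.1, hst.2.2.1, sub_self, abs_zero] at h3
  rw [hst.2.1, abs_sub_comm s, abs_of_nonneg (sub_nonneg.2 sc)] at h4
  rw [hst.2.2.1, abs_sub_comm c t, abs_of_nonneg (sub_nonneg.2 ct)] at h5
  have h6 := mul_le_mul_of_nonneg_left h2 (by linarith : (0 : ℝ) ≤ κ)
  have h7 : κ * dp s t = 2 * (κ * w) := by rw [h1]; ring
  linarith [S.κδ_le, neg_abs_le (m - h c), le_abs_self (h c - m)]

/-- Some excursion of the path above its end points merges almost as high as they do. -/
lemma exists_excursion (S : CutPath δ κ κp κq μp μq L h dp dq k R ρ t₀ t₁)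
    (hD : 4 * ρ < dp 0 L - |h 0 - h L|) : ∃ a b, 0 ≤ a ∧ b ≤ L ∧
      Excursion h (max (h 0) (h L)) a b ∧ merge h dp 0 L - 2 * ρ ≤ merge h dp a b := by
  by_contra! hcon
  have hL := S.mem₀.1.trans S.mem₀.2
  set v := max (h 0) (h L) with hv
  have hδ := S.δ_pos
  have hm := merge_eq_max_add h dp 0 L
  rw [← hv] at hm
  set B := merge h dp 0 L - 2 * ρ with hB
  have hvB : v ≤ B := by linarith
  obtain ⟨s, t, s0, sc, ct, tL, hs, ht, hst⟩ := exists_interval_above S.P.continuous (M := v)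
    (le_max_left _ _) (le_max_right _ _) S.mem₀.1 S.mem₀.2
  have h1 : merge h dp s t ≤ B := by
    rcases hst with hst | hst
    · rw [← hst, S.P.merge_self]; linarith
    · exact (hcon s t s0 tL hst).le
  have h2 : merge h dp 0 s ≤ B + (3 * k + 13) * δ := by
    have key : ∀ c, c = t₀ ∨ c = t₁ → 0 ≤ c → c ≤ s → h c ≤ v := by
      rintro c (rfl | rfl) _ h2
      · rwa [le_antisymm h2 sc]
      · exact (S.min_le s ⟨s0, (sc.trans ct).trans tL⟩).trans hs
    exact S.P.merge_le_of_threeLegs hδ.le S.legs S.R_le le_rfl s0 ((sc.trans ct).trans tL)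
      (le_max_left _ _) hs (key _ (min_choice _ _)) (key _ (max_choice _ _)) hvB
      fun a b h1 h2 h3 => (hcon a b h1 (h2.trans ((sc.trans ct).trans tL)) h3).le
  have h3 : merge h dp t L ≤ B + (3 * k + 13) * δ := by
    have key : ∀ c, c = t₀ ∨ c = t₁ → t ≤ c → c ≤ L → h c ≤ v := by
      rintro c (rfl | rfl) h2 _
      · rwa [le_antisymm ct h2]
      · exact (S.min_le t ⟨(s0.trans sc).trans ct, tL⟩).trans ht
    exact S.P.merge_le_of_threeLegs hδ.le S.legs S.R_le ((s0.trans sc).trans ct) tL le_rfl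
      ht (le_max_right _ _) (key _ (min_choice _ _)) (key _ (max_choice _ _)) hvB
      fun a b h1 h2 h3 => (hcon a b (((s0.trans sc).trans ct).trans h1) h2 h3).le
  have hkδ : 0 ≤ (k : ℝ) * δ := by positivity
  have h4 := (S.P.four s t L).trans (add_le_add_left
    (max_le (h1.trans (by linarith : B ≤ B + (3 * k + 13) * δ)) h3) _)
  have h5 := (S.P.four 0 s L).trans (add_le_add_left
    (max_le (h2.trans (by linarith : _ ≤ B + (3 * k + 13) * δ + 3 * δ)) h4) _)
  have h6 := S.ρ_eq
  linarith

lemma turn (S : CutPath δ κ κp κq μp μq L h dp dq k R ρ t₀ t₁) :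
    μp * (dp 0 L - |h 0 - h L|) ≤ 258 * (κ * ρ) := by
  have hκ := S.one_le
  have hρ := S.ρ_pos
  have hκρ := S.ρ_le
  have hμ0 := S.μp_nonneg
  have hμρ := mul_le_mul_of_nonneg_right S.μp_le hρ.le
  rcases le_or_gt (dp 0 L - |h 0 - h L|) (4 * ρ) with hD | hD
  · have := mul_le_mul_of_nonneg_left hD hμ0
    linarith
  rcases le_or_gt κp 1 with hp | hp
  · rw [S.μp_eq, max_eq_left (by linarith), zero_mul]; linarith
  have hμ : μp = κp - 1 := by rw [S.μp_eq, max_eq_right (by linarith)]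
  obtain ⟨a, b, ha, hb, he, hmab⟩ := S.exists_excursion hD
  rw [merge_eq_max_add] at hmab
  have hd := he.merge_eq (d := dp)
  have hq := S.dq_le_of_excursion ha hb he
  obtain ⟨c, hc, hmax⟩ := isCompact_Icc.exists_isMaxOn (Set.nonempty_Icc.2 he.1)
    S.P.continuous.continuousOn
  have h1 := Excursion.leg_up S ha hb he hc hmax
  have h2 := Excursion.leg_down S ha hb he hc hmax
  have h3 := S.overshoot ha hb he hc hmax
  have h4 := he.2.2.2 c hc
  rw [Leg, he.2.1, abs_sub_comm, abs_of_nonneg (by linarith)] at h1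
  rw [Leg, he.2.2.1, abs_of_nonneg (by linarith)] at h2
  have h5 := S.dp_le a b he.1
  have h6 := mul_le_mul_of_nonneg_left hq (by linarith [S.κ_le_q] : 0 ≤ κq)
  have h7 : (κp + κq) * ρ = κ * ρ := by rw [S.κ_eq]
  have h8 : 0 ≤ κp * ρ := by positivity
  have h9 := mul_le_mul_of_nonneg_left (by linarith : dp 0 L - |h 0 - h L| ≤ dp a b + 4 * ρ) hμ0
  have h10 : μp * dp a b = κp * dp a b - dp a b := by rw [hμ]; ring
  linarith

lemma excess_le (S : CutPath δ κ κp κq μp μq L h dp dq k R ρ t₀ t₁) :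
    L - (dp 0 L + dq 0 L - |h 0 - h L|) ≤ 1034 * (κ * ρ) := by
  have h1 := S.turn
  have h2 := S.swap.turn
  have h3 := S.upper 0 L le_rfl (S.mem₀.1.trans S.mem₀.2) le_rfl
  have h4 : - h 0 - - h L = -(h 0 - h L) := by ring
  simp only [h4, abs_neg] at h2
  have h5 := S.κδ_le
  have h6 := S.ρ_le
  have := S.ρ_pos
  linarith

end CutPath

lemma exists_scale_lt {K : ℝ} {k : ℕ} (hk : ⌈K⌉₊ + 30 ≤ k) :
    4152 * (K * (3 * k + 14)) < 2 ^ k := by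
  have main : ∀ j : ℕ, 4152 * (((j : ℝ) + 30) * (3 * ((j : ℝ) + 30) + 14)) < 2 ^ (j + 30) := by
    intro j
    induction j with
    | zero => norm_num
    | succ j ih =>
      have h1 : (2 : ℝ) ^ (j + 1 + 30) = 2 * 2 ^ (j + 30) := by ring
      rw [h1]
      push_cast
      nlinarith [Nat.cast_nonneg (α := ℝ) j]
  obtain ⟨j, rfl⟩ : ∃ j, k = j + 30 := ⟨k - 30, by omega⟩
  have h1 : K ≤ (j : ℝ) + 30 := by
    have h2 : ((⌈K⌉₊ : ℕ) : ℝ) ≤ j := by exact_mod_cast (by omega : ⌈K⌉₊ ≤ j)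
    linarith [Nat.le_ceil K]
  have h2 := mul_le_mul_of_nonneg_right h1 (by positivity : 0 ≤ 3 * ((j : ℝ) + 30) + 14)
  have h3 := main j
  push_cast
  linarith

lemma threeLegs_of_lip {h : ℝ → ℝ} (hlip : ∀ s t, |h s - h t| ≤ |s - t|) {L c₁ c₂ : ℝ}
    (h1 : 0 ≤ c₁) (h2 : c₁ ≤ c₂) (h3 : c₂ ≤ L) {R : ℝ}
    (hR : L - (|h 0 - h c₁| + |h c₁ - h c₂| + |h c₂ - h L|) ≤ R) : ThreeLegs h R L c₁ c₂ := by
  have key : ∀ s t, s ≤ t → |h s - h t| ≤ t - s := fun s t hst => by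
    simpa only [abs_sub_comm s, abs_of_nonneg (sub_nonneg.2 hst)] using hlip s t
  have := key 0 c₁ h1
  have := key c₁ c₂ h2
  have := key c₂ L h3
  exact ⟨h1, h2, h3, by unfold Leg; linarith, by unfold Leg; linarith, by unfold Leg; linarith⟩

/-- The extremal heights along the path are the heights at which its end points merge. -/
theorem HoroPath.extremal_heights {δ κ κp κq μp μq L : ℝ} {h : ℝ → ℝ} {dp dq : ℝ → ℝ → ℝ}
    (C : HoroPath δ κ κp κq μp μq L h dp dq) (hL : 0 ≤ L) :
    ∃ t₀ ∈ Set.Icc 0 L, ∃ t₁ ∈ Set.Icc 0 L, (∀ u ∈ Set.Icc 0 L, h u ≤ h t₀) ∧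
      (∀ u ∈ Set.Icc 0 L, h t₁ ≤ h u) ∧
      |h t₀ - merge h dp 0 L| ≤ 518 * κ * (3 * κ + 107) * δ ∧
      |- h t₁ - merge (fun t => - h t) dq 0 L| ≤ 518 * κ * (3 * κ + 107) * δ := by
  have hδ := C.δ_pos
  have hκ := C.one_le
  obtain ⟨t₀, ht₀, hmax⟩ := isCompact_Icc.exists_isMaxOn (Set.nonempty_Icc.2 hL)
    C.P.continuous.continuousOn
  obtain ⟨t₁, ht₁, hmin⟩ := isCompact_Icc.exists_isMinOn (Set.nonempty_Icc.2 hL)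
    C.P.continuous.continuousOn
  replace hmax : ∀ u ∈ Set.Icc 0 L, h u ≤ h t₀ := hmax
  replace hmin : ∀ u ∈ Set.Icc 0 L, h t₁ ≤ h u := hmin
  refine ⟨t₀, ht₀, t₁, ht₁, hmax, hmin, ?_⟩
  have m0 : 0 ∈ Set.Icc 0 L := ⟨le_rfl, hL⟩
  have mL : L ∈ Set.Icc 0 L := ⟨hL, le_rfl⟩
  set V := |h 0 - h (min t₀ t₁)| + |h (min t₀ t₁) - h (max t₀ t₁)| + |h (max t₀ t₁) - h L| with hV
  have hV' : 2 * h t₀ - 2 * h t₁ - |h 0 - h L| ≤ V := by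
    have := hmax 0 m0
    have := hmax L mL
    have := hmin 0 m0
    have := hmin L mL
    rcases le_total t₀ t₁ with h1 | h1
    · rw [hV, min_eq_left h1, max_eq_right h1]
      linarith [neg_abs_le (h 0 - h t₀), le_abs_self (h t₀ - h t₁), le_abs_self (h 0 - h L),
        neg_abs_le (h t₁ - h L), neg_abs_le (h 0 - h L)]
    · rw [hV, min_eq_right h1, max_eq_left h1]
      linarith [le_abs_self (h 0 - h t₁), neg_abs_le (h t₁ - h t₀), le_abs_self (h 0 - h L),
        le_abs_self (h t₀ - h L), neg_abs_le (h 0 - h L)]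
  have hc₁ : 0 ≤ min t₀ t₁ := le_min ht₀.1 ht₁.1
  have hc₂ : max t₀ t₁ ≤ L := max_le ht₀.2 ht₁.2
  have hVL : V ≤ L := by
    have key : ∀ s t, s ≤ t → |h s - h t| ≤ t - s := fun s t hst => by
      simpa only [abs_sub_comm s, abs_of_nonneg (sub_nonneg.2 hst)] using C.P.abs_sub_le s t
    linarith [key _ _ hc₁, key _ _ hc₂, key _ _ (min_le_max (a := t₀) (b := t₁))]
  have cut : ∀ k : ℕ, ⌈κ⌉₊ + 30 ≤ k → 2 * (L - V) ≤ δ * 2 ^ k →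
      CutPath δ κ κp κq μp μq L h dp dq k (δ * 2 ^ k / 2) ((3 * k + 14) * δ) t₀ t₁ := by
    intro k hk hVk
    refine ⟨C, rfl, by linarith, ?_, ht₀, ht₁, hmax, hmin,
      threeLegs_of_lip C.P.abs_sub_le hc₁ min_le_max hc₂ (by linarith)⟩
    have h1 := mul_le_mul_of_nonneg_right (exists_scale_lt hk).le hδ.le
    have h2 : 0 ≤ κ * (3 * k + 14) * δ := by positivity
    linarith
  have est : ∀ k : ℕ, ⌈κ⌉₊ + 30 ≤ k → 2 * (L - V) ≤ δ * 2 ^ k →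
      merge h dp 0 L ≤ h t₀ + (3 * k + 14) * δ ∧
      merge (fun t => - h t) dq 0 L ≤ - h t₁ + (3 * k + 14) * δ ∧
      L - (dp 0 L + dq 0 L - |h 0 - h L|) ≤ 1034 * (κ * ((3 * k + 14) * δ)) := fun k hk hVk =>
    have S := cut k hk hVk
    ⟨S.merge_le le_rfl hL le_rfl fun u h1 h2 => hmax u ⟨h1, h2⟩,
      S.swap.merge_le le_rfl hL le_rfl fun u h1 h2 => neg_le_neg (hmin u ⟨h1, h2⟩), S.excess_le⟩
  have hex : ∃ k : ℕ, ⌈κ⌉₊ + 30 ≤ k ∧ 2 * (L - V) ≤ δ * 2 ^ k := by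
    obtain ⟨j, hj⟩ := pow_unbounded_of_one_lt (2 * (L - V) / δ) (one_lt_two (α := ℝ))
    refine ⟨⌈κ⌉₊ + 30 + j, by omega, ?_⟩
    rw [div_lt_iff₀' hδ] at hj
    exact hj.le.trans (mul_le_mul_of_nonneg_left
      (pow_le_pow_right₀ one_le_two (by omega)) hδ.le)
  obtain ⟨k, ⟨hk, hVk⟩, hkmin⟩ : ∃ k : ℕ, (⌈κ⌉₊ + 30 ≤ k ∧ 2 * (L - V) ≤ δ * 2 ^ k) ∧
      ∀ j < k, ¬ (⌈κ⌉₊ + 30 ≤ j ∧ 2 * (L - V) ≤ δ * 2 ^ j) :=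
    ⟨Nat.find hex, Nat.find_spec hex, fun j hj => Nat.find_min hex hj⟩
  obtain ⟨e1, e2, e3⟩ := est k hk hVk
  have m1 : merge h dp 0 L = (h 0 + h L + dp 0 L) / 2 := rfl
  have m2 : merge (fun t => - h t) dq 0 L = (- h 0 + - h L + dq 0 L) / 2 := rfl
  have hρκ : (3 * k + 14) * δ ≤ κ * ((3 * k + 14) * δ) :=
    le_mul_of_one_le_left (by positivity) hκ
  have hkeq : k = ⌈κ⌉₊ + 30 := by
    by_contra hne
    obtain ⟨j, rfl⟩ : ∃ j, k = j + 1 := ⟨k - 1, by omega⟩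
    refine hkmin j (by omega) ⟨by omega, ?_⟩
    have h1 := mul_le_mul_of_nonneg_right (exists_scale_lt hk).le hδ.le
    rw [pow_succ] at h1
    linarith
  have hkκ : (k : ℝ) ≤ κ + 31 := by
    rw [hkeq]; push_cast; linarith [Nat.ceil_lt_add_one (by linarith : 0 ≤ κ)]
  have hρ : 518 * (κ * ((3 * k + 14) * δ)) ≤ 518 * κ * (3 * κ + 107) * δ := by
    have : κ * δ * (3 * k + 14) ≤ κ * δ * (3 * κ + 107) :=
      mul_le_mul_of_nonneg_left (by linarith) (by positivity)
    linarith
  constructor <;> rw [abs_le] <;> constructor <;> linarith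

/-- A geodesic space with a height function `f` satisfying the properties of the height of a proper,
geodesically complete, hyperbolic space relative to a boundary point. -/
structure HeightSpace {X : Type*} [MetricSpace X] (δ : ℝ) (f : X → ℝ) : Prop where
  geod : GeodesicSpace X
  lip : ∀ x y, |f x - f y| ≤ dist x y
  four : ∀ x y z, merge f dist x z ≤ max (merge f dist x y) (merge f dist y z) + 3 * δ
  up : ∀ x ℓ, 0 ≤ ℓ → ∃ u, dist x u = ℓ ∧ f u = f x + ℓ
  down : ∀ x ℓ, 0 ≤ ℓ → ∃ u, dist x u = ℓ ∧ f u = f x - ℓ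

section Height

variable {X : Type*} [MetricSpace X] {δ : ℝ}

lemma IsGeodSegment.dist_left {γ : ℝ → X} {x y : X} (hγ : IsGeodSegment γ x y) {t : ℝ}
    (ht : t ∈ Set.Icc 0 (dist x y)) : dist x (γ t) = t := by
  have h := hγ.1 0 ⟨le_rfl, dist_nonneg⟩ t ht
  rwa [hγ.2.1, zero_sub, abs_neg, abs_of_nonneg ht.1] at h

lemma IsGeodSegment.dist_right {γ : ℝ → X} {x y : X} (hγ : IsGeodSegment γ x y) {t : ℝ}
    (ht : t ∈ Set.Icc 0 (dist x y)) : dist (γ t) y = dist x y - t := by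
  have h := hγ.1 t ht (dist x y) ⟨dist_nonneg, le_rfl⟩
  rwa [hγ.2.2, abs_sub_comm, abs_of_nonneg (sub_nonneg.2 ht.2)] at h

/-- The four point inequality of a space with slim triangles. -/
lemma DeltaHyperbolic.four_point (hX : DeltaHyperbolic X δ) (x y z w : X) :
    dist x z - dist x w - dist z w ≤
      max (dist x y - dist x w - dist y w) (dist y z - dist y w - dist z w) + 6 * δ := by
  obtain ⟨g, hg⟩ := hX.1 x z
  obtain ⟨zw, hzw⟩ := hX.1 z w
  obtain ⟨wx, hwx⟩ := hX.1 w x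
  obtain ⟨zy, hzy⟩ := hX.1 z y
  obtain ⟨yx, hyx⟩ := hX.1 y x
  set s := (dist x w + dist x z - dist z w) / 2 with hs
  have hsmem : s ∈ Set.Icc 0 (dist x z) :=
    ⟨by linarith [dist_triangle z x w, dist_comm z x], by linarith [dist_triangle x z w]⟩
  have hxp := hg.dist_left hsmem
  have hpz := hg.dist_right hsmem
  set p := g s
  have hwp : dist w p ≤ (dist x w + dist z w - dist x z) / 2 + 2 * δ := by
    obtain ⟨u, ⟨r, hr, rfl⟩ | ⟨r, hr, rfl⟩, hd⟩ := hX.2 x z w g zw wx hg hzw hwx s hsmem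
    · have h1 := hzw.dist_left hr
      have h2 := hzw.dist_right hr
      linarith [dist_triangle w (zw r) p, dist_triangle p (zw r) z, dist_comm (zw r) w,
        dist_comm z (zw r), dist_comm p (zw r)]
    · have h1 := hwx.dist_left hr
      have h2 := hwx.dist_right hr
      linarith [dist_triangle w (wx r) p, dist_triangle x (wx r) p, dist_comm (wx r) p,
        dist_comm x (wx r), dist_comm w x]
  obtain ⟨u, ⟨r, hr, rfl⟩ | ⟨r, hr, rfl⟩, hd⟩ := hX.2 x z y g zy yx hg hzy hyx s hsmem
  · refine le_trans ?_ (add_le_add_left (le_max_right _ _) _)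
    have h1 := hzy.dist_left hr
    have h2 := hzy.dist_right hr
    linarith [dist_triangle w p (zy r), dist_triangle z (zy r) w, dist_triangle y (zy r) w,
      dist_comm (zy r) w, dist_comm y (zy r), dist_comm y z]
  · refine le_trans ?_ (add_le_add_left (le_max_left _ _) _)
    have h1 := hyx.dist_left hr
    have h2 := hyx.dist_right hr
    linarith [dist_triangle w p (yx r), dist_triangle x (yx r) w, dist_triangle y (yx r) w,
      dist_comm (yx r) w, dist_comm x (yx r), dist_comm y x]

lemma IsRayFrom.dist_eq {w : X} {a : ℝ → X} (ha : IsRayFrom w a) {t : ℝ} (ht : 0 ≤ t) :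
    dist w (a t) = t := by
  have h := ha.1 0 (Set.mem_Ici.2 le_rfl) t (Set.mem_Ici.2 ht)
  rwa [ha.2, zero_sub, abs_neg, abs_of_nonneg ht] at h

/-- In a Busemann space asymptotic rays with the same origin coincide. -/
lemma BusemannSpace.ray_unique (hB : BusemannSpace X) {w : X} {a k : ℝ → X} (ha : IsRayFrom w a)
    (hk : IsRayFrom w k) (hak : FinHausRays a k) {t : ℝ} (ht : 0 ≤ t) : a t = k t := by
  obtain ⟨C, hC, -⟩ := hak
  have hbd : ∀ s, 0 ≤ s → dist (a s) (k s) ≤ 2 * C := by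
    intro s hs
    obtain ⟨u, hu, hd⟩ := hC s hs
    have h1 := hk.1 u hu s hs
    have h2 : |u - s| ≤ C := by
      have h3 := ha.dist_eq hs
      have h4 := hk.dist_eq hu
      rw [abs_le]
      constructor <;> linarith [dist_triangle w (a s) (k u), dist_triangle w (k u) (a s),
        dist_comm (a s) (k u)]
    linarith [dist_triangle (a s) (k u) (k s)]
  by_contra hne
  have hpos : 0 < dist (a t) (k t) := dist_pos.2 hne
  have ht0 : 0 < t := by
    refine lt_of_le_of_ne ht fun h0 => hne ?_
    rw [← h0, ha.2, hk.2]
  have hC0 : 0 ≤ C := by linarith [hbd t ht]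
  set T := t + t * (2 * C) / dist (a t) (k t) with hT
  have hdiv : 0 ≤ t * (2 * C) / dist (a t) (k t) := by positivity
  have hTt : t ≤ T := by linarith
  have hT0 : 0 < T := by linarith
  have hsub : Set.Icc 0 T ⊆ Set.Ici (0 : ℝ) := fun s hs => hs.1
  have hconv := hB.2 0 T 0 T a k (fun s hs u hu => ha.1 s (hsub hs) u (hsub hu))
    (fun s hs u hu => hk.1 s (hsub hs) u (hsub hu))
  have h0 : (0 : ℝ) ∈ Set.Icc 0 T := ⟨le_rfl, hT0.le⟩
  have hTT : T ∈ Set.Icc 0 T := ⟨hT0.le, le_rfl⟩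
  have h1 := hconv.2 (Set.mk_mem_prod h0 h0) (Set.mk_mem_prod hTT hTT)
    (sub_nonneg.2 ((div_le_one hT0).2 hTt)) (by positivity : 0 ≤ t / T) (sub_add_cancel 1 _)
  have h2 : t / T * T = t := div_mul_cancel₀ _ hT0.ne'
  simp only [Prod.smul_mk, Prod.mk_add_mk, smul_eq_mul, mul_zero, zero_add, h2, ha.2, hk.2,
    dist_self] at h1
  have h3 := mul_le_mul_of_nonneg_left (hbd T hT0.le) (by positivity : 0 ≤ t / T)
  have h4 : dist (a t) (k t) * T ≤ t * (2 * C) := by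
    have h5 := mul_le_mul_of_nonneg_right (h1.trans h3) hT0.le
    rwa [mul_right_comm, h2] at h5
  rw [hT, mul_add, mul_div_cancel₀ _ hpos.ne'] at h4
  nlinarith [mul_pos hpos ht0]

lemma IsRayFrom.exists_tendsto {w : X} {a : ℝ → X} (ha : IsRayFrom w a) (x : X) :
    ∃ l, Tendsto (fun t => dist x (a t) - t) atTop (nhds l) := by
  have hanti : Antitone fun t : ℝ => dist x (a (max t 0)) - max t 0 := by
    intro s t hst
    have h1 := ha.1 (max s 0) (le_max_right s 0) (max t 0) (le_max_right t 0)
    have h2 : max s 0 ≤ max t 0 := max_le_max hst le_rfl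
    rw [abs_sub_comm, abs_of_nonneg (sub_nonneg.2 h2)] at h1
    have := dist_triangle x (a (max s 0)) (a (max t 0))
    show dist x (a (max t 0)) - max t 0 ≤ dist x (a (max s 0)) - max s 0
    linarith
  have hbdd : BddBelow (Set.range fun t : ℝ => dist x (a (max t 0)) - max t 0) := by
    refine ⟨- dist w x, ?_⟩
    rintro _ ⟨t, rfl⟩
    have := ha.dist_eq (le_max_right t 0)
    show - dist w x ≤ dist x (a (max t 0)) - max t 0
    linarith [dist_triangle w x (a (max t 0))]
  refine ⟨_, (tendsto_atTop_ciInf hanti hbdd).congr' ?_⟩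
  filter_upwards [eventually_ge_atTop 0] with t ht
  rw [max_eq_left ht]

lemma BusemannSpace.tendsto_height (hB : BusemannSpace X) {w : X} {a : ℝ → X}
    (ha : IsRayFrom w a) (x : X) :
    Tendsto (fun t => t - dist x (a t)) atTop (nhds (height w a x)) := by
  obtain ⟨l, hl⟩ := ha.exists_tendsto x
  have hset : { b : ℝ | ∃ k : ℝ → X, IsRayFrom w k ∧ FinHausRays a k ∧
      b = Filter.limsup (fun t => dist x (k t) - t) Filter.atTop } = {l} := by
    ext b
    constructor
    · rintro ⟨k, hk, hak, rfl⟩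
      refine (hl.congr' ?_).limsup_eq
      filter_upwards [eventually_ge_atTop 0] with t ht
      rw [hB.ray_unique ha hk hak ht]
    · rintro rfl
      exact ⟨a, ha, ⟨0, fun s hs => ⟨s, hs, by simp⟩, fun s hs => ⟨s, hs, by simp⟩⟩,
        hl.limsup_eq.symm⟩
  rw [height, busemann, hset, csSup_singleton]
  simpa using hl.neg

/-- A compactness argument: a height difference realised at all finite stages is realised. -/
lemma exists_of_forall_exists [ProperSpace X] {f : X → ℝ} {a : ℝ → X}
    (hf : ∀ x, Tendsto (fun t => t - dist x (a t)) atTop (nhds (f x))) {x : X} {ℓ c : ℝ}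
    (h : ∀ n : ℕ, ∃ T, (n : ℝ) ≤ T ∧ ∃ u, dist x u = ℓ ∧ dist u (a T) = dist x (a T) - c) :
    ∃ u, dist x u = ℓ ∧ f u = f x + c := by
  choose T hT u hu hd using h
  obtain ⟨v, hv, φ, hφ, hlim⟩ := (isCompact_sphere x ℓ).tendsto_subseq
    (fun n => Metric.mem_sphere'.2 (hu n))
  refine ⟨v, Metric.mem_sphere'.1 hv, ?_⟩
  have hTφ : Tendsto (fun n => T (φ n)) atTop atTop :=
    (tendsto_atTop_mono hT tendsto_natCast_atTop_atTop).comp hφ.tendsto_atTop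
  have h1 := (hf v).comp hTφ
  have h2 := ((hf x).comp hTφ).add_const c
  have h3 : Tendsto (fun n => dist (u (φ n)) v) atTop (nhds 0) :=
    tendsto_iff_dist_tendsto_zero.1 hlim
  refine eq_of_abs_sub_nonpos (le_of_tendsto_of_tendsto (h1.sub h2).abs h3 ?_)
  filter_upwards with n
  simp only [Function.comp]
  rw [show T (φ n) - dist v (a (T (φ n))) - (T (φ n) - dist x (a (T (φ n))) + c) =
    dist (u (φ n)) (a (T (φ n))) - dist v (a (T (φ n))) by rw [hd]; ring]
  exact abs_dist_sub_le _ _ _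

theorem heightSpace_height [ProperSpace X] (hX : DeltaHyperbolic X δ) (hB : BusemannSpace X)
    (hG : GeodesicallyComplete X) {w : X} {a : ℝ → X} (ha : IsRayFrom w a) :
    HeightSpace δ (height w a) where
  geod := hX.1
  lip := fun x y => by
    refine le_of_tendsto ((hB.tendsto_height ha x).sub (hB.tendsto_height ha y)).abs ?_
    filter_upwards with t
    rw [show t - dist x (a t) - (t - dist y (a t)) = dist y (a t) - dist x (a t) by ring,
      dist_comm x y]
    exact abs_dist_sub_le _ _ _
  four := fun x y z => by
    have key : ∀ u v, Tendsto (fun t => (t - dist u (a t) + (t - dist v (a t)) + dist u v) / 2) atTop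
        (nhds (merge (height w a) dist u v)) := fun u v =>
      (((hB.tendsto_height ha u).add (hB.tendsto_height ha v)).add_const _).div_const 2
    refine le_of_tendsto_of_tendsto' (key x z) (((key x y).max (key y z)).add_const _) fun t => ?_
    rcases le_max_iff.1 (sub_le_iff_le_add.2 (hX.four_point x y z (a t))) with h | h
    · refine le_trans ?_ (add_le_add_left (le_max_left _ _) _)
      linarith
    · refine le_trans ?_ (add_le_add_left (le_max_right _ _) _)
      linarith
  up := fun x ℓ hℓ => by
    refine exists_of_forall_exists (hB.tendsto_height ha) fun n => ?_
    have hT : (0 : ℝ) ≤ max (n : ℝ) (ℓ + dist w x) := (Nat.cast_nonneg n).trans (le_max_left _ _)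
    refine ⟨max (n : ℝ) (ℓ + dist w x), le_max_left _ _, ?_⟩
    obtain ⟨γ, hγ⟩ := hX.1 x (a (max (n : ℝ) (ℓ + dist w x)))
    have hm : ℓ ∈ Set.Icc 0 (dist x (a (max (n : ℝ) (ℓ + dist w x)))) := by
      refine ⟨hℓ, ?_⟩
      linarith [ha.dist_eq hT, dist_triangle w x (a (max (n : ℝ) (ℓ + dist w x))),
        le_max_right (n : ℝ) (ℓ + dist w x)]
    exact ⟨γ ℓ, hγ.dist_left hm, hγ.dist_right hm⟩
  down := fun x ℓ hℓ => by
    refine exists_of_forall_exists (c := -ℓ) (hB.tendsto_height ha) fun n => ⟨n, le_rfl, ?_⟩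
    obtain ⟨γ, hγ⟩ := hX.1 x (a n)
    obtain ⟨γ', hl, hγ'⟩ := hG 0 _ γ dist_nonneg hγ.1
    have h0 := hγ' 0 ⟨le_rfl, dist_nonneg⟩
    have h1 := hγ' _ ⟨dist_nonneg, le_rfl⟩
    rw [hγ.2.1] at h0
    rw [hγ.2.2] at h1
    refine ⟨γ' (-ℓ), ?_, ?_⟩
    · have := hl 0 trivial (-ℓ) trivial
      rwa [h0, sub_neg_eq_add, zero_add, abs_of_nonneg hℓ] at this
    · have := hl (-ℓ) trivial (dist x (a n)) trivial
      rw [h1, abs_sub_comm, abs_of_nonneg (by linarith [dist_nonneg (x := x) (y := a n)])] at this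
      exact this

/-- A section of the height function through a given point: a piece of vertical geodesic. -/
lemma HeightSpace.exists_section {f : X → ℝ} (hf : HeightSpace δ f) {z : X} {lo hi : ℝ}
    (hlo : lo ≤ f z) (hhi : f z ≤ hi) : ∃ V : ℝ → X, V (f z) = z ∧
      (∀ s ∈ Set.Icc lo hi, f (V s) = s) ∧
      ∀ s ∈ Set.Icc lo hi, ∀ t ∈ Set.Icc lo hi, dist (V s) (V t) = |s - t| := by
  obtain ⟨u, hu, hfu⟩ := hf.up z (hi - f z) (sub_nonneg.2 hhi)
  obtain ⟨v, hv, hfv⟩ := hf.down z (f z - lo) (sub_nonneg.2 hlo)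
  obtain ⟨g, hg⟩ := hf.geod z u
  obtain ⟨g', hg'⟩ := hf.geod z v
  have hup : ∀ s, f z ≤ s → s ≤ hi → s - f z ∈ Set.Icc 0 (dist z u) := fun s h1 h2 =>
    ⟨by linarith, by linarith⟩
  have hdown : ∀ s, lo ≤ s → s ≤ f z → f z - s ∈ Set.Icc 0 (dist z v) := fun s h1 h2 =>
    ⟨by linarith, by linarith⟩
  set V : ℝ → X := fun s => if f z ≤ s then g (s - f z) else g' (f z - s) with hV
  have V1 : ∀ s, f z ≤ s → V s = g (s - f z) := fun s h => if_pos h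
  have V2 : ∀ s, s ≤ f z → V s = g' (f z - s) := fun s h => by
    rcases h.eq_or_lt with rfl | h
    · rw [V1 _ le_rfl, sub_self, hg.2.1, hg'.2.1]
    · exact if_neg (not_le.2 h)
  have hz : V (f z) = z := by rw [V1 _ le_rfl, sub_self, hg.2.1]
  have hsec : ∀ s ∈ Set.Icc lo hi, f (V s) = s := by
    rintro s ⟨h1, h2⟩
    rcases le_total (f z) s with h | h
    · have h3 := hg.dist_left (hup s h h2)
      have h4 := hg.dist_right (hup s h h2)
      rw [V1 s h]
      have h5 := (abs_le.1 (hf.lip z (g (s - f z)))).1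
      have h6 := (abs_le.1 (hf.lip (g (s - f z)) u)).1
      linarith
    · have h3 := hg'.dist_left (hdown s h1 h)
      have h4 := hg'.dist_right (hdown s h1 h)
      rw [V2 s h]
      have h5 := (abs_le.1 (hf.lip z (g' (f z - s)))).2
      have h6 := (abs_le.1 (hf.lip (g' (f z - s)) v)).2
      linarith
  refine ⟨V, hz, hsec, fun s hs t ht => ?_⟩
  wlog hst : s ≤ t generalizing s t
  · rw [dist_comm, abs_sub_comm]; exact this t ht s hs (le_of_not_ge hst)
  rcases le_total (f z) s with h | h
  · rw [V1 s h, V1 t (h.trans hst), hg.1 _ (hup s h hs.2) _ (hup t (h.trans hst) ht.2)]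
    congr 1; ring
  rcases le_total t (f z) with h' | h'
  · rw [V2 s h, V2 t h', hg'.1 _ (hdown s hs.1 h) _ (hdown t ht.1 h'), abs_sub_comm]
    congr 1; ring
  · refine le_antisymm ?_ ?_
    · have h3 := hg.dist_left (hup t h' ht.2)
      have h4 := hg'.dist_left (hdown s hs.1 h)
      rw [V2 s h, V1 t h', abs_sub_comm, abs_of_nonneg (sub_nonneg.2 hst)]
      linarith [dist_triangle_left (g' (f z - s)) (g (t - f z)) z]
    · have := hf.lip (V s) (V t)
      rwa [hsec s hs, hsec t ht] at this

end Height

namespace AdmNorm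

variable (N : AdmNorm)

lemma scale (c a b : ℝ) (hc : 0 ≤ c) : N.toFun (c * a, c * b) = c * N.toFun (a, b) := by
  have h := N.smul_eq c (a, b)
  rwa [Prod.smul_mk, smul_eq_mul, smul_eq_mul, abs_of_nonneg hc] at h

lemma neg (a b : ℝ) : N.toFun (-a, -b) = N.toFun (a, b) := by
  have h := N.smul_eq (-1) (a, b)
  simpa using h

lemma add_le' (a b c d : ℝ) : N.toFun (a + c, b + d) ≤ N.toFun (a, b) + N.toFun (c, d) :=
  N.add_le (a, b) (c, d)

lemma swap_mul_sub_le {a b : ℝ} (ha : 0 ≤ a) (hb : 0 ≤ b) :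
    N.toFun (0, 1) * b ≤ N.toFun (a, b) + N.toFun (1, 0) * a := by
  have h1 := N.add_le' a b (-a) (-0)
  have h2 := N.scale b 0 1 hb
  have h3 := N.scale a 1 0 ha
  rw [N.neg] at h1
  simp only [mul_zero, mul_one, add_neg_cancel, neg_zero, add_zero] at h1 h2 h3
  linarith

lemma mul_sub_le {a b : ℝ} (ha : 0 ≤ a) (hb : 0 ≤ b) :
    N.toFun (1, 0) * a ≤ N.toFun (a, b) + N.toFun (0, 1) * b := by
  have h1 := N.add_le' a b (-0) (-b)
  have h2 := N.scale b 0 1 hb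
  have h3 := N.scale a 1 0 ha
  rw [N.neg] at h1
  simp only [mul_zero, mul_one, add_neg_cancel, neg_zero, add_zero] at h1 h2 h3
  linarith

lemma half_le_left : 1 / 2 ≤ N.toFun (1, 0) := by simpa using N.adm 1 0

lemma half_le_right : 1 / 2 ≤ N.toFun (0, 1) := by simpa using N.adm 0 1

lemma one_le_add : 1 ≤ N.toFun (1, 0) + N.toFun (0, 1) := by
  simpa [N.one_one] using N.add_le' 1 0 0 1

lemma right_le : N.toFun (0, 1) ≤ 1 + N.toFun (1, 0) := by
  simpa [N.one_one] using N.swap_mul_sub_le zero_le_one zero_le_one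

lemma left_le : N.toFun (1, 0) ≤ 1 + N.toFun (0, 1) := by
  simpa [N.one_one] using N.mul_sub_le zero_le_one zero_le_one

/-- A bound of the norm near the diagonal. -/
lemma le_near_diag {a b m e e' : ℝ} (ha : 0 ≤ a) (hb : 0 ≤ b) (ham : a ≤ m) (hbm : b ≤ m)
    (hab : a ≤ b + e) (hba : b ≤ a + e') (he : 0 ≤ e) (he' : 0 ≤ e') :
    N.toFun (a, b) ≤ m + max 0 (N.toFun (1, 0) - 1) * e + max 0 (N.toFun (0, 1) - 1) * e' := by
  have hμ := le_max_left 0 (N.toFun (1, 0) - 1)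
  have hμ' := le_max_left 0 (N.toFun (0, 1) - 1)
  have h0 := mul_nonneg hμ he
  have h0' := mul_nonneg hμ' he'
  rcases le_total b a with h | h
  · have h1 := N.add_le' b b (a - b) 0
    have h2 := N.scale b 1 1 hb
    have h3 := N.scale (a - b) 1 0 (sub_nonneg.2 h)
    have h4 := mul_le_mul_of_nonneg_right (le_max_right 0 (N.toFun (1, 0) - 1)) (sub_nonneg.2 h)
    have h5 := mul_le_mul_of_nonneg_left (by linarith : a - b ≤ e) hμ
    simp only [mul_one, mul_zero, add_sub_cancel, add_zero, N.one_one] at h1 h2 h3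
    linarith
  · have h1 := N.add_le' a a 0 (b - a)
    have h2 := N.scale a 1 1 ha
    have h3 := N.scale (b - a) 0 1 (sub_nonneg.2 h)
    have h4 := mul_le_mul_of_nonneg_right (le_max_right 0 (N.toFun (0, 1) - 1)) (sub_nonneg.2 h)
    have h5 := mul_le_mul_of_nonneg_left (by linarith : b - a ≤ e') hμ'
    simp only [mul_one, mul_zero, add_sub_cancel, add_zero, N.one_one] at h1 h2 h3
    linarith

end AdmNorm

section Product

variable {Xp Xq : Type*} [MetricSpace Xp] [MetricSpace Xq] {δ : ℝ}

lemma le_dHN (Nf : ℝ × ℝ → ℝ) (mem : Xp × Xq → Prop) (x y : Xp × Xq) :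
    ENNReal.ofReal (Nf (dist y.1 x.1, dist y.2 x.2)) ≤ dHN Nf mem x y := by
  refine le_iInf fun T => le_iInf fun hT => le_iInf fun γ => le_iInf fun _ => le_iInf fun _ =>
    le_iInf fun h0 => le_iInf fun h1 => ?_
  have hmono : Monotone fun i : ℕ => if i = 0 then 0 else T := by
    intro i j hij
    by_cases hi : i = 0 <;> by_cases hj : j = 0
    · simp [hi, hj]
    · simp [hi, hj, hT]
    · omega
    · simp [hi, hj]
  have hmem : ∀ i : ℕ, (if i = 0 then 0 else T) ∈ Set.Icc 0 T := by
    intro i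
    split_ifs
    · exact ⟨le_rfl, hT⟩
    · exact ⟨hT, le_rfl⟩
  have h := le_iSup (fun p : ℕ × { u : ℕ → ℝ // Monotone u ∧ ∀ i, u i ∈ Set.Icc 0 T } =>
    ∑ i ∈ Finset.range p.1, ENNReal.ofReal (Nf (dist (γ (p.2.1 (i+1))).1 (γ (p.2.1 i)).1,
      dist (γ (p.2.1 (i+1))).2 (γ (p.2.1 i)).2))) (1, ⟨_, hmono, hmem⟩)
  unfold lN
  simpa [h0, h1] using h

lemma dHN_le {Nf : ℝ × ℝ → ℝ} {mem : Xp × Xq → Prop} {x y : Xp × Xq} {T : ℝ} (hT : 0 ≤ T)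
    {γ : ℝ → Xp × Xq} (hγ : ContinuousOn γ (Set.Icc 0 T)) (hmem : ∀ t ∈ Set.Icc 0 T, mem (γ t))
    (h0 : γ 0 = x) (h1 : γ T = y) {φ : ℝ → ℝ} (hφ : Monotone φ)
    (hN : ∀ s t, 0 ≤ s → s ≤ t → t ≤ T →
      Nf (dist (γ t).1 (γ s).1, dist (γ t).2 (γ s).2) ≤ φ t - φ s) :
    dHN Nf mem x y ≤ ENNReal.ofReal (φ T - φ 0) := by
  refine iInf_le_of_le T <| iInf_le_of_le hT <| iInf_le_of_le γ <| iInf_le_of_le hγ <|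
    iInf_le_of_le hmem <| iInf_le_of_le h0 <| iInf_le_of_le h1 <| iSup_le ?_
  rintro ⟨n, u, hu, huI⟩
  calc _ ≤ ∑ i ∈ Finset.range n, ENNReal.ofReal (φ (u (i + 1)) - φ (u i)) :=
        Finset.sum_le_sum fun i _ => ENNReal.ofReal_le_ofReal
          (hN _ _ (huI i).1 (hu i.le_succ) (huI (i + 1)).2)
    _ = ENNReal.ofReal (φ (u n) - φ (u 0)) := by
        rw [← ENNReal.ofReal_sum_of_nonneg fun i _ => sub_nonneg.2 (hφ (hu i.le_succ)),
          Finset.sum_range_sub fun i => φ (u i)]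
    _ ≤ _ := ENNReal.ofReal_le_ofReal (sub_le_sub (hφ (huI n).2) (hφ (huI 0).1))

lemma continuousOn_of_dist_le {X : Type*} [MetricSpace X] {P : ℝ → X} {I : Set ℝ}
    (h : ∀ a ∈ I, ∀ b ∈ I, a ≤ b → dist (P a) (P b) ≤ b - a) : ContinuousOn P I := by
  refine (LipschitzOnWith.of_dist_le_mul (K := 1) fun a ha b hb => ?_).continuousOn
  rw [NNReal.coe_one, one_mul, Real.dist_eq]
  rcases le_total a b with hab | hab
  · rw [abs_sub_comm, abs_of_nonneg (sub_nonneg.2 hab)]; exact h a ha b hb hab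
  · rw [dist_comm, abs_of_nonneg (sub_nonneg.2 hab)]; exact h b hb a ha hab

/-- A path that is vertical up to time `c`, with height `H`, and geodesic afterwards. -/
lemma dist_le_of_vertical_geodesic {X : Type*} [MetricSpace X] {P : ℝ → X} {H : ℝ → ℝ} {I : Set ℝ}
    {c : ℝ} (hc : c ∈ I) (hH : ∀ a ∈ I, ∀ b ∈ I, a ≤ b → |H a - H b| ≤ b - a)
    (hV : ∀ a ∈ I, ∀ b ∈ I, a ≤ c → b ≤ c → dist (P a) (P b) = |H a - H b|)
    (hG : ∀ a ∈ I, ∀ b ∈ I, c ≤ a → c ≤ b → dist (P a) (P b) = |a - b|)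
    {a b : ℝ} (ha : a ∈ I) (hb : b ∈ I) (hab : a ≤ b) : dist (P a) (P b) ≤ b - a ∧
      dist (P a) (P b) ≤ |H a - H b| + 2 * (max (b - c) 0 - max (a - c) 0) := by
  have h1 := hH a ha b hb hab
  rcases le_total b c with hbc | hcb
  · rw [hV a ha b hb (hab.trans hbc) hbc, max_eq_right (by linarith), max_eq_right (by linarith)]
    exact ⟨h1, by linarith⟩
  rcases le_total c a with hca | hac
  · rw [hG a ha b hb hca hcb, max_eq_left (by linarith), max_eq_left (by linarith),
      abs_sub_comm a, abs_of_nonneg (sub_nonneg.2 hab)]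
    exact ⟨le_rfl, by linarith [abs_nonneg (H a - H b)]⟩
  · rw [max_eq_left (by linarith), max_eq_right (by linarith)]
    have h2 := dist_triangle (P a) (P c) (P b)
    rw [hV a ha c hc hac le_rfl, hG c hc b hb le_rfl hcb, abs_sub_comm c,
      abs_of_nonneg (sub_nonneg.2 hcb)] at h2
    have h3 := hH a ha c hc hac
    have h4 := hH c hc b hb hcb
    have h5 := abs_sub_le (H a) (H b) (H c)
    rw [abs_sub_comm (H b)] at h5
    exact ⟨by linarith, by linarith⟩

/-- A path that is geodesic up to time `c`, and vertical afterwards, with height `H`. -/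
lemma dist_le_of_geodesic_vertical {X : Type*} [MetricSpace X] {P : ℝ → X} {H : ℝ → ℝ} {I : Set ℝ}
    {c : ℝ} (hc : c ∈ I) (hH : ∀ a ∈ I, ∀ b ∈ I, a ≤ b → |H a - H b| ≤ b - a)
    (hG : ∀ a ∈ I, ∀ b ∈ I, a ≤ c → b ≤ c → dist (P a) (P b) = |a - b|)
    (hV : ∀ a ∈ I, ∀ b ∈ I, c ≤ a → c ≤ b → dist (P a) (P b) = |H a - H b|)
    {a b : ℝ} (ha : a ∈ I) (hb : b ∈ I) (hab : a ≤ b) : dist (P a) (P b) ≤ b - a ∧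
      dist (P a) (P b) ≤ |H a - H b| + 2 * (min b c - min a c) := by
  have h := dist_le_of_vertical_geodesic (P := fun t => P (-t)) (H := fun t => H (-t))
    (I := {t | -t ∈ I}) (c := -c) (a := -b) (b := -a) (by simpa using hc)
    (fun a ha b hb hab => by
      rw [abs_sub_comm]; linarith [hH (-b) hb (-a) ha (neg_le_neg hab)])
    (fun a ha b hb h1 h2 => hV _ ha _ hb (by linarith) (by linarith))
    (fun a ha b hb h1 h2 => by
      rw [hG _ ha _ hb (by linarith) (by linarith), abs_sub_comm]; congr 1; ring)
    (by simpa using hb) (by simpa using ha) (neg_le_neg hab)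
  have h1 : max (-a - -c) 0 - max (-b - -c) 0 = min b c - min a c := by
    rcases le_total a c with h1 | h1 <;> rcases le_total b c with h2 | h2 <;>
      simp only [h1, h2, min_eq_left, min_eq_right]
    · rw [max_eq_left (by linarith), max_eq_left (by linarith)]; ring
    · rw [max_eq_left (by linarith), max_eq_right (by linarith)]; ring
    · rw [max_eq_right (by linarith), max_eq_left (by linarith)]; linarith
    · rw [max_eq_right (by linarith), max_eq_right (by linarith)]; ring
  simp only [neg_neg, h1] at h
  rw [dist_comm, abs_sub_comm]
  exact ⟨by linarith [h.1], h.2⟩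

/-- The vertical geodesic through `z` at the level of `z'` ends near `z'`. -/
lemma HeightSpace.dist_le_of_section {X : Type*} [MetricSpace X] {f : X → ℝ}
    (hf : HeightSpace δ f) {z z' p : X} (hzz' : f z ≤ f z') (hp : f p = f z')
    (hd : dist p z = f z' - f z) :
    dist p z' ≤ dist z z' - |f z - f z'| + 6 * δ := by
  have h1 := hf.four p z z'
  have h2 := hf.lip z z'
  rw [merge_eq_max_add, merge_eq_max_add, merge_eq_max_add, hd, hp, max_self, max_eq_left hzz',
    max_eq_right hzz', abs_of_nonneg (sub_nonneg.2 hzz'), sub_self, sub_self, abs_zero, zero_div,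
    add_zero, max_eq_right (by linarith)] at h1
  linarith

/-- Going down vertically in `Xp` and up in `Xq`, or the opposite, with detours of bounded length,
is an efficient way of joining two points of the horospherical product. -/
theorem dHN_le_of_le {fp : Xp → ℝ} {fq : Xq → ℝ} (hp : HeightSpace δ fp) (hq : HeightSpace δ fq)
    (hδ : 0 ≤ δ) (N : AdmNorm) {mem : Xp × Xq → Prop} (hmem : ∀ z, mem z ↔ fp z.1 + fq z.2 = 0)
    {z z' : Xp × Xq} (hz : mem z) (hz' : mem z') (hle : fp z.1 ≤ fp z'.1) :
    dHN N.toFun mem z z' ≤ ENNReal.ofReal (|fp z.1 - fp z'.1|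
      + (1 + 2 * max 0 (N.toFun (1, 0) - 1)) * (dist z.1 z'.1 - |fp z.1 - fp z'.1|)
      + (1 + 2 * max 0 (N.toFun (0, 1) - 1)) * (dist z.2 z'.2 - |fp z.1 - fp z'.1|)
      + 24 * (N.toFun (1, 0) + N.toFun (0, 1)) * δ) := by
  rw [hmem] at hz hz'
  obtain ⟨zp, zq⟩ := z
  obtain ⟨zp', zq'⟩ := z'
  dsimp only at *
  set t₀ := fp zp
  set t₁ := fp zp'
  have hfq : fq zq = - t₀ := by linarith
  have hfq' : fq zq' = - t₁ := by linarith
  have hΔ : |t₀ - t₁| = t₁ - t₀ := by rw [abs_sub_comm, abs_of_nonneg (by linarith)]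
  have hDp : 0 ≤ dist zp zp' - |t₀ - t₁| := sub_nonneg.2 (hp.lip zp zp')
  have hDq : 0 ≤ dist zq zq' - |t₀ - t₁| := by
    have := hq.lip zq' zq
    rw [hfq, hfq', neg_sub_neg, dist_comm] at this
    linarith
  set Dp := dist zp zp' - |t₀ - t₁|
  set Dq := dist zq zq' - |t₀ - t₁| with hDq_def
  set lo := t₀ - (Dp + Dq + 12 * δ) with hlo
  set hi := t₁ + (Dp + Dq + 12 * δ) with hhi
  obtain ⟨Vp, hVz, hVf, hVd⟩ := hp.exists_section (z := zp) (lo := lo) (hi := hi)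
    (by linarith) (by linarith)
  obtain ⟨Vq, hWz, hWf, hWd⟩ := hq.exists_section (z := zq') (lo := -hi) (hi := -lo)
    (by linarith) (by linarith)
  rw [hfq'] at hWz
  have m₀ : t₀ ∈ Set.Icc lo hi := ⟨by linarith, by linarith⟩
  have m₁ : t₁ ∈ Set.Icc lo hi := ⟨by linarith, by linarith⟩
  have mneg : ∀ s ∈ Set.Icc lo hi, -s ∈ Set.Icc (-hi) (-lo) := fun s hs =>
    ⟨neg_le_neg hs.2, neg_le_neg hs.1⟩
  have hd₃ : dist (Vp t₁) zp' ≤ Dp + 6 * δ := by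
    refine hp.dist_le_of_section hle (hVf _ m₁) ?_
    have := hVd t₁ m₁ t₀ m₀
    rwa [hVz, abs_of_nonneg (by linarith)] at this
  have hd₁ : dist zq (Vq (-t₀)) ≤ Dq + 6 * δ := by
    have h1 := hq.dist_le_of_section (z := zq') (z' := zq) (p := Vq (-t₀)) (by linarith)
      (by rw [hWf _ (mneg _ m₀), hfq]) (by
        have := hWd _ (mneg _ m₀) _ (mneg _ m₁)
        rw [hWz, abs_of_nonneg (by linarith)] at this
        linarith)
    rw [hfq, hfq', neg_sub_neg, dist_comm, dist_comm zq'] at h1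
    exact h1
  obtain ⟨σ, hσ⟩ := hq.geod zq (Vq (-t₀))
  obtain ⟨τ, hτ⟩ := hp.geod (Vp t₁) zp'
  have hd₁0 : 0 ≤ dist zq (Vq (-t₀)) := dist_nonneg
  have hd₃0 : 0 ≤ dist (Vp t₁) zp' := dist_nonneg
  have hfq₁ : fq (Vq (-t₀)) = -t₀ := hWf _ (mneg _ m₀)
  have hfp₂ : fp (Vp t₁) = t₁ := hVf _ m₁
  set d₁ := dist zq (Vq (-t₀)) with hd₁_def
  set d₃ := dist (Vp t₁) zp' with hd₃_def
  set T₂ := d₁ + (t₁ - t₀) with hT₂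
  set T := T₂ + d₃ with hT
  have hT0 : 0 ≤ T := by linarith
  set I := Set.Icc 0 T with hI
  have mem₁ : d₁ ∈ I := ⟨hd₁0, by linarith⟩
  have mem₂ : T₂ ∈ I := ⟨by linarith, by linarith⟩
  set l₁ : ℝ → ℝ := fun t => min t d₁ with hl₁
  set l₃ : ℝ → ℝ := fun t => max (t - T₂) 0 with hl₃
  have l₁_mono : Monotone l₁ := fun a b hab => min_le_min hab le_rfl
  have l₃_mono : Monotone l₃ := fun a b hab => max_le_max (sub_le_sub_right hab _) le_rfl
  have l₂_mono : ∀ a b, a ≤ b → a - l₁ a - l₃ a ≤ b - l₁ b - l₃ b := by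
    intro a b hab
    simp only [hl₁, hl₃]
    rcases le_total a d₁ with h1 | h1 <;> rcases le_total b d₁ with h2 | h2 <;>
      rcases le_total (a - T₂) 0 with h3 | h3 <;> rcases le_total (b - T₂) 0 with h4 | h4 <;>
      simp only [h1, h2, h3, h4, min_eq_left, min_eq_right, max_eq_left, max_eq_right] <;> linarith
  have l₁_mem : ∀ t ∈ I, l₁ t ∈ Set.Icc 0 d₁ := fun t ht => ⟨le_min ht.1 hd₁0, min_le_right _ _⟩
  have l₃_mem : ∀ t ∈ I, l₃ t ∈ Set.Icc 0 d₃ := fun t ht =>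
    ⟨le_max_right _ _, max_le (by linarith [ht.2]) hd₃0⟩
  have l₁_eq : ∀ t, t ≤ d₁ → l₁ t = t := fun t h => min_eq_left h
  have l₁_eq' : ∀ t, d₁ ≤ t → l₁ t = d₁ := fun t h => min_eq_right h
  have l₃_eq : ∀ t, t ≤ T₂ → l₃ t = 0 := fun t h => max_eq_right (by linarith)
  have l₃_eq' : ∀ t, T₂ ≤ t → l₃ t = t - T₂ := fun t h => max_eq_left (by linarith)
  -- the height at time `t`
  set H : ℝ → ℝ := fun t => - fq (σ (l₁ t)) + (t - l₁ t - l₃ t) + (fp (τ (l₃ t)) - t₁) with hH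
  have H_lip : ∀ a ∈ I, ∀ b ∈ I, a ≤ b → |H a - H b| ≤ b - a := by
    intro a ha b hb hab
    have h1 := hq.lip (σ (l₁ a)) (σ (l₁ b))
    have h3 := hp.lip (τ (l₃ a)) (τ (l₃ b))
    rw [hσ.1 _ (l₁_mem a ha) _ (l₁_mem b hb), abs_sub_comm (l₁ a),
      abs_of_nonneg (sub_nonneg.2 (l₁_mono hab)), abs_le] at h1
    rw [hτ.1 _ (l₃_mem a ha) _ (l₃_mem b hb), abs_sub_comm (l₃ a),
      abs_of_nonneg (sub_nonneg.2 (l₃_mono hab)), abs_le] at h3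
    have h2 := l₂_mono a b hab
    simp only [hH, abs_le]
    constructor <;> linarith
  have H_q : ∀ t, t ≤ d₁ → H t = - fq (σ t) := fun t h => by
    simp only [hH]
    rw [l₁_eq t h, l₃_eq t (by linarith), hτ.2.1, hfp₂]; ring
  have H_p : ∀ t, T₂ ≤ t → H t = fp (τ (t - T₂)) := fun t h => by
    simp only [hH]
    rw [l₁_eq' t (by linarith), l₃_eq' t h, hσ.2.2, hfq₁, hT₂]; ring
  have H_0 : H 0 = t₀ := by rw [H_q 0 hd₁0, hσ.2.1, hfq, neg_neg]
  have H_1 : H d₁ = t₀ := by rw [H_q d₁ le_rfl, hσ.2.2, hfq₁, neg_neg]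
  have H_2 : H T₂ = t₁ := by rw [H_p T₂ le_rfl, sub_self, hτ.2.1, hfp₂]
  have H_T : H T = t₁ := by
    rw [H_p T (by linarith), show T - T₂ = d₃ by ring, hτ.2.2]
  have H_mem : ∀ t ∈ I, H t ∈ Set.Icc lo hi := by
    intro t ht
    have h1 := abs_le.1 (H_lip 0 ⟨le_rfl, hT0⟩ t ht ht.1)
    have h2 := abs_le.1 (H_lip t ht T ⟨hT0, le_rfl⟩ ht.2)
    rw [H_0] at h1
    rw [H_T] at h2
    have := ht.1
    have := ht.2
    constructor <;> linarith
  set P : ℝ → Xp := fun t => if t ≤ T₂ then Vp (H t) else τ (t - T₂) with hP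
  set Q : ℝ → Xq := fun t => if t ≤ d₁ then σ t else Vq (- H t) with hQ
  have P_le : ∀ t, t ≤ T₂ → P t = Vp (H t) := fun t h => if_pos h
  have P_ge : ∀ t, T₂ ≤ t → P t = τ (t - T₂) := fun t h => by
    rcases h.eq_or_lt with rfl | h
    · rw [P_le _ le_rfl, H_2, sub_self, hτ.2.1]
    · exact if_neg (not_le.2 h)
  have Q_le : ∀ t, t ≤ d₁ → Q t = σ t := fun t h => if_pos h
  have Q_ge : ∀ t, d₁ ≤ t → Q t = Vq (- H t) := fun t h => by
    rcases h.eq_or_lt with rfl | h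
    · rw [Q_le _ le_rfl, H_1, hσ.2.2]
    · exact if_neg (not_le.2 h)
  have P_dist : ∀ a ∈ I, ∀ b ∈ I, a ≤ b → dist (P a) (P b) ≤ b - a ∧
      dist (P a) (P b) ≤ |H a - H b| + 2 * (l₃ b - l₃ a) := fun a ha b hb hab =>
    dist_le_of_vertical_geodesic mem₂ H_lip
      (fun a ha b hb h1 h2 => by rw [P_le a h1, P_le b h2, hVd _ (H_mem a ha) _ (H_mem b hb)])
      (fun a ha b hb h1 h2 => by
        rw [P_ge a h1, P_ge b h2, ← l₃_eq' a h1, ← l₃_eq' b h2,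
          hτ.1 _ (l₃_mem a ha) _ (l₃_mem b hb), l₃_eq' a h1, l₃_eq' b h2]
        congr 1; ring) ha hb hab
  have Q_dist : ∀ a ∈ I, ∀ b ∈ I, a ≤ b → dist (Q a) (Q b) ≤ b - a ∧
      dist (Q a) (Q b) ≤ |H a - H b| + 2 * (l₁ b - l₁ a) := fun a ha b hb hab =>
    dist_le_of_geodesic_vertical mem₁ H_lip
      (fun a ha b hb h1 h2 => by
        rw [Q_le a h1, Q_le b h2, hσ.1 _ ⟨ha.1, h1⟩ _ ⟨hb.1, h2⟩])
      (fun a ha b hb h1 h2 => by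
        rw [Q_ge a h1, Q_ge b h2, hWd _ (mneg _ (H_mem a ha)) _ (mneg _ (H_mem b hb)),
          neg_sub_neg, abs_sub_comm]) ha hb hab
  have P_h : ∀ t ∈ I, fp (P t) = H t := fun t ht => by
    rcases le_total t T₂ with h | h
    · rw [P_le t h, hVf _ (H_mem t ht)]
    · rw [P_ge t h, H_p t h]
  have Q_h : ∀ t ∈ I, fq (Q t) = - H t := fun t ht => by
    rcases le_total t d₁ with h | h
    · rw [Q_le t h, H_q t h, neg_neg]
    · rw [Q_ge t h, hWf _ (mneg _ (H_mem t ht))]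
  have hμp : 0 ≤ max 0 (N.toFun (1, 0) - 1) := le_max_left _ _
  have hμq : 0 ≤ max 0 (N.toFun (0, 1) - 1) := le_max_left _ _
  have hμp' : max 0 (N.toFun (1, 0) - 1) ≤ N.toFun (1, 0) - 1 / 2 :=
    max_le (by linarith [N.half_le_left]) (by linarith)
  have hμq' : max 0 (N.toFun (0, 1) - 1) ≤ N.toFun (0, 1) - 1 / 2 :=
    max_le (by linarith [N.half_le_right]) (by linarith)
  set μp := max 0 (N.toFun (1, 0) - 1)
  set μq := max 0 (N.toFun (0, 1) - 1)
  refine (dHN_le hT0 (γ := fun t => (P t, Q t)) (φ := fun t => t + 2 * μp * l₃ t + 2 * μq * l₁ t)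
    ((continuousOn_of_dist_le fun a ha b hb hab => (P_dist a ha b hb hab).1).prodMk
      (continuousOn_of_dist_le fun a ha b hb hab => (Q_dist a ha b hb hab).1))
    (fun t ht => (hmem _).2 (by rw [P_h t ht, Q_h t ht, add_neg_cancel])) ?_ ?_ ?_ ?_).trans ?_
  · show (P 0, Q 0) = (zp, zq)
    rw [P_le 0 (by linarith), H_0, hVz, Q_le 0 hd₁0, hσ.2.1]
  · show (P T, Q T) = (zp', zq')
    rw [P_ge T (by linarith), show T - T₂ = d₃ by ring, hτ.2.2, Q_ge T (by linarith), H_T, hWz]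
  · intro a b hab
    have h1 := mul_le_mul_of_nonneg_left (l₃_mono hab) (by linarith : 0 ≤ 2 * μp)
    have h2 := mul_le_mul_of_nonneg_left (l₁_mono hab) (by linarith : 0 ≤ 2 * μq)
    simp only
    linarith
  · intro s t hs hst ht
    have hsI : s ∈ I := ⟨hs, hst.trans ht⟩
    have htI : t ∈ I := ⟨hs.trans hst, ht⟩
    have h1 := P_dist s hsI t htI hst
    have h2 := Q_dist s hsI t htI hst
    have h3 := hp.lip (P s) (P t)
    have h4 := hq.lip (Q s) (Q t)
    rw [P_h s hsI, P_h t htI] at h3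
    rw [Q_h s hsI, Q_h t htI, neg_sub_neg, abs_sub_comm] at h4
    have h5 := l₁_mono hst
    have h6 := l₃_mono hst
    have h7 := N.le_near_diag (a := dist (P s) (P t)) (b := dist (Q s) (Q t)) dist_nonneg
      dist_nonneg h1.1 h2.1 (e := 2 * (l₃ t - l₃ s)) (e' := 2 * (l₁ t - l₁ s)) (by linarith)
      (by linarith) (by linarith) (by linarith)
    simp only
    rw [dist_comm (P t), dist_comm (Q t)]
    linarith
  · refine ENNReal.ofReal_le_ofReal ?_
    have e1 : l₃ T = d₃ := by rw [l₃_eq' T (by linarith)]; ring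
    have e2 : l₃ 0 = 0 := l₃_eq 0 (by linarith)
    have e3 : l₁ T = d₁ := l₁_eq' T (by linarith)
    have e4 : l₁ 0 = 0 := l₁_eq 0 hd₁0
    simp only [e1, e2, e3, e4, hΔ]
    have h1 := mul_le_mul_of_nonneg_left hd₃ hμp
    have h2 := mul_le_mul_of_nonneg_left hd₁ hμq
    have h3 := mul_le_mul_of_nonneg_right hμp' hδ
    have h4 := mul_le_mul_of_nonneg_right hμq' hδ
    have h5 : 0 ≤ (N.toFun (1, 0) + N.toFun (0, 1)) * δ :=
      mul_nonneg (by linarith [N.one_le_add]) hδ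
    linarith

end Product

section Geodesic

variable {Xp Xq : Type*} [MetricSpace Xp] [MetricSpace Xq] {δ : ℝ}

lemma abs_clamp_sub_le (L s t : ℝ) :
    |max 0 (min s L) - max 0 (min t L)| ≤ |s - t| := by
  have h1 := abs_max_sub_max_le_abs (min s L) (min t L) 0
  have h2 := abs_min_sub_min_le_max s L t L
  rw [sub_self, abs_zero, max_eq_left (abs_nonneg _)] at h2
  rw [max_comm 0, max_comm 0]
  exact h1.trans h2

/-- The heights and distances along a geodesic of the horospherical product, extended by constants
outside of its domain. -/
theorem horoPath_of_geodesic {fp : Xp → ℝ} {fq : Xq → ℝ} (hp : HeightSpace δ fp)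
    (hq : HeightSpace δ fq) (hδ : 0 < δ) (N : AdmNorm) {mem : Xp × Xq → Prop}
    (hmem : ∀ z, mem z ↔ fp z.1 + fq z.2 = 0) {L : ℝ} (hL : 0 ≤ L) {α : ℝ → Xp × Xq}
    (hα : IsHNGeodesicOn N.toFun mem α (Set.Icc 0 L)) :
    HoroPath δ (N.toFun (1, 0) + N.toFun (0, 1)) (N.toFun (1, 0)) (N.toFun (0, 1))
      (max 0 (N.toFun (1, 0) - 1)) (max 0 (N.toFun (0, 1) - 1)) L
      (fun t => fp (α (max 0 (min t L))).1)
      (fun s t => dist (α (max 0 (min s L))).1 (α (max 0 (min t L))).1)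
      (fun s t => dist (α (max 0 (min s L))).2 (α (max 0 (min t L))).2) := by
  set β : ℝ → Xp × Xq := fun t => α (max 0 (min t L)) with hβ
  have hc : ∀ t, max 0 (min t L) ∈ Set.Icc 0 L := fun t =>
    ⟨le_max_left _ _, max_le hL (min_le_right _ _)⟩
  have hfq : ∀ t, fq (β t).2 = - fp (β t).1 := fun t => by
    linarith [(hmem _).1 (hα.1 _ (hc t))]
  have hN : ∀ s t, s ≤ t →
      N.toFun (dist (β s).1 (β t).1, dist (β s).2 (β t).2) ≤ t - s := by
    intro s t hst
    have h1 := le_dHN N.toFun mem (β t) (β s)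
    rw [hα.2 _ (hc t) _ (hc s), ENNReal.ofReal_le_ofReal_iff (abs_nonneg _)] at h1
    refine h1.trans ((abs_clamp_sub_le L t s).trans ?_)
    rw [abs_of_nonneg (sub_nonneg.2 hst)]
  have hpl : ∀ s t, |fp (β s).1 - fp (β t).1| ≤ dist (β s).1 (β t).1 := fun s t => hp.lip _ _
  have hql : ∀ s t, |fp (β s).1 - fp (β t).1| ≤ dist (β s).2 (β t).2 := fun s t => by
    have := hq.lip (β s).2 (β t).2
    rwa [hfq, hfq, neg_sub_neg, abs_sub_comm] at this
  have hadm : ∀ s t, s ≤ t → dist (β s).1 (β t).1 + dist (β s).2 (β t).2 ≤ 2 * (t - s) :=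
    fun s t hst => by linarith [hN s t hst, N.adm (dist (β s).1 (β t).1) (dist (β s).2 (β t).2)]
  have habs : ∀ s t, |- fp (β s).1 - - fp (β t).1| = |fp (β s).1 - fp (β t).1| := fun s t => by
    rw [neg_sub_neg, abs_sub_comm]
  refine ⟨⟨fun s t => dist_comm _ _, fun s => dist_self _, hpl,
      fun s t hst => by linarith [hadm s t hst, hql s t], fun s t u => hp.four _ _ _⟩,
    ⟨fun s t => dist_comm _ _, fun s => dist_self _, fun s t => (habs s t).trans_le (hql s t),
      fun s t hst => by
        have h1 := hadm s t hst
        have h2 := hpl s t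
        have h3 := habs s t
        show dist (β s).2 (β t).2 ≤ 2 * (t - s) - |- fp (β s).1 - - fp (β t).1|
        linarith, fun s t u => ?_⟩,
    hδ, rfl, N.one_le_add, by linarith [N.half_le_left, N.right_le],
    by linarith [N.half_le_right, N.left_le], rfl, rfl,
    fun s t hst => by
      linarith [N.mul_sub_le (a := dist (β s).1 (β t).1) (b := dist (β s).2 (β t).2)
        dist_nonneg dist_nonneg, hN s t hst],
    fun s t hst => by
      linarith [N.swap_mul_sub_le (a := dist (β s).1 (β t).1) (b := dist (β s).2 (β t).2)
        dist_nonneg dist_nonneg, hN s t hst], fun s t hs hst ht => ?_⟩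
  · have h1 := hq.four (β s).2 (β t).2 (β u).2
    simp only [merge, hfq] at h1 ⊢
    exact h1
  · have key : ∀ a b, dHN N.toFun mem (β a) (β b) = ENNReal.ofReal (t - s) →
        fp (β a).1 ≤ fp (β b).1 → t - s ≤ |fp (β a).1 - fp (β b).1|
          + (1 + 2 * max 0 (N.toFun (1, 0) - 1))
            * (dist (β a).1 (β b).1 - |fp (β a).1 - fp (β b).1|)
          + (1 + 2 * max 0 (N.toFun (0, 1) - 1))
            * (dist (β a).2 (β b).2 - |fp (β a).1 - fp (β b).1|)
          + 24 * (N.toFun (1, 0) + N.toFun (0, 1)) * δ := by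
      intro a b hab hle
      have h1 := dHN_le_of_le hp hq hδ.le N hmem (hα.1 _ (hc a)) (hα.1 _ (hc b)) hle
      refine (ENNReal.ofReal_le_ofReal_iff ?_).1 (hab.symm.trans_le h1)
      have h2 : 0 ≤ max 0 (N.toFun (1, 0) - 1) := le_max_left _ _
      have h3 : 0 ≤ max 0 (N.toFun (0, 1) - 1) := le_max_left _ _
      have h4 : 0 ≤ N.toFun (1, 0) + N.toFun (0, 1) := by linarith [N.one_le_add]
      have h5 := sub_nonneg.2 (hpl a b)
      have h6 := sub_nonneg.2 (hql a b)
      positivity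
    have hcs : max 0 (min s L) = s := by rw [min_eq_left (by linarith), max_eq_right hs]
    have hct : max 0 (min t L) = t := by rw [min_eq_left ht, max_eq_right (by linarith)]
    rcases le_total (fp (β s).1) (fp (β t).1) with hle | hle
    · refine key s t ?_ hle
      rw [hα.2 _ (hc s) _ (hc t), hcs, hct, abs_sub_comm, abs_of_nonneg (sub_nonneg.2 hst)]
    · have h1 := key t s (by
        rw [hα.2 _ (hc t) _ (hc s), hcs, hct, abs_of_nonneg (sub_nonneg.2 hst)]) hle
      rw [abs_sub_comm, dist_comm, dist_comm (β t).2] at h1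
      exact h1

end Geodesic

lemma error_le {κ δ C E : ℝ} (hκ : 1 ≤ κ) (hκC : κ ≤ C) (hδ : 1 ≤ δ) (hE : 0 ≤ E) :
    518 * κ * (3 * κ + 107) * δ ≤ 4 * (2853 * δ * C + E) ^ 2 := by
  have hC : 1 ≤ C := hκ.trans hκC
  have h1 : 3 * κ + 107 ≤ 110 * C := by linarith
  have h2 : κ * (3 * κ + 107) ≤ C * (110 * C) :=
    mul_le_mul hκC h1 (by linarith) (by linarith)
  have h3 : (2853 * δ * C) ^ 2 ≤ (2853 * δ * C + E) ^ 2 :=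
    pow_le_pow_left₀ (by positivity) (by linarith) 2
  have h4 : δ * C ^ 2 ≤ (δ * C) ^ 2 := by
    rw [mul_pow]
    exact mul_le_mul_of_nonneg_right (le_self_pow₀ hδ two_ne_zero) (by positivity)
  have h5 := mul_le_mul_of_nonneg_right h2 (by linarith : 0 ≤ δ)
  have h6 : 0 ≤ δ * C ^ 2 := by positivity
  linarith

/-- The maximal and minimal heights of a geodesic of the
horospherical product are determined up to `4C₀` by the relative distances of
the components of its endpoints. -/
theorem statement16 {Hp Hq : Type*} [MetricSpace Hp] [MetricSpace Hq]
    [ProperSpace Hp] [ProperSpace Hq]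
    (δ : ℝ) (hδ : 1 ≤ δ)
    (hHp : DeltaHyperbolic Hp δ) (hHq : DeltaHyperbolic Hq δ)
    (hBp : BusemannSpace Hp) (hBq : BusemannSpace Hq)
    (hGp : GeodesicallyComplete Hp) (hGq : GeodesicallyComplete Hq)
    (wp : Hp) (ap : ℝ → Hp) (hap : IsRayFrom wp ap)
    (wq : Hq) (aq : ℝ → Hq) (haq : IsRayFrom wq aq)
    (N : AdmNorm) (CN : ℝ) (hCN : N.BoundConst CN)
    (C₀ : ℝ) (hC₀ : C₀ = (2853 * δ * CN + 2 ^ (851:ℕ)) ^ 2)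
    (x y : Hp × Hq) (hx : inHoro wp ap wq aq x) (hy : inHoro wp ap wq aq y)
    (hxy : height wp ap x.1 ≤ height wp ap y.1)
    (L : ℝ) (hL : 0 ≤ L) (α : ℝ → Hp × Hq)
    (hα : IsHNGeodesicOn N.toFun (inHoro wp ap wq aq) α (Set.Icc 0 L))
    (hα0 : α 0 = x) (hαL : α L = y) :
    |hminusH wp ap α (Set.Icc 0 L)
        - (height wp ap x.1 - dr wq aq x.2 y.2 / 2)| ≤ 4 * C₀ ∧
    |hplusH wp ap α (Set.Icc 0 L)
        - (height wp ap y.1 + dr wp ap x.1 y.1 / 2)| ≤ 4 * C₀ := by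
  have hp := heightSpace_height hHp hBp hGp hap
  have hq := heightSpace_height hHq hBq hGq haq
  have hC := horoPath_of_geodesic hp hq (by linarith) N (fun _ => Iff.rfl) hL hα
  have hκ : N.toFun (1, 0) + N.toFun (0, 1) ≤ CN := by
    linarith [hCN.2 1 0 zero_le_one le_rfl, hCN.2 0 1 le_rfl zero_le_one]
  obtain ⟨t₀, ht₀, t₁, ht₁, hmax, hmin, h₀, h₁⟩ := hC.extremal_heights hL
  have herr : 518 * (N.toFun (1, 0) + N.toFun (0, 1))
      * (3 * (N.toFun (1, 0) + N.toFun (0, 1)) + 107) * δ ≤ 4 * C₀ :=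
    hC₀ ▸ error_le N.one_le_add hκ hδ (by positivity)
  have hc : ∀ t ∈ Set.Icc 0 L, max 0 (min t L) = t := fun t ht => by
    rw [min_eq_left ht.2, max_eq_right ht.1]
  have hplus : hplusH wp ap α (Set.Icc 0 L) = height wp ap (α t₀).1 :=
    IsGreatest.csSup_eq ⟨⟨t₀, ht₀, rfl⟩, by
      rintro _ ⟨t, ht, rfl⟩
      simpa only [hc t ht, hc t₀ ht₀] using hmax t ht⟩
  have hminus : hminusH wp ap α (Set.Icc 0 L) = height wp ap (α t₁).1 :=
    IsLeast.csInf_eq ⟨⟨t₁, ht₁, rfl⟩, by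
      rintro _ ⟨t, ht, rfl⟩
      simpa only [hc t ht, hc t₁ ht₁] using hmin t ht⟩
  have hqx : height wq aq x.2 = - height wp ap x.1 := by unfold inHoro at hx; linarith
  have hqy : height wq aq y.2 = - height wp ap y.1 := by unfold inHoro at hy; linarith
  have hΔ : |height wp ap x.1 - height wp ap y.1| = height wp ap y.1 - height wp ap x.1 := by
    rw [abs_sub_comm, abs_of_nonneg (by linarith)]
  simp only [merge, hc 0 ⟨le_rfl, hL⟩, hc L ⟨hL, le_rfl⟩, hc t₀ ht₀, hc t₁ ht₁, hα0, hαL] at h₀ h₁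
  rw [hplus, hminus, dr, dr, dh, dh, hqx, hqy, neg_sub_neg, abs_sub_comm (height wp ap y.1), hΔ]
  constructor
  · refine le_trans (le_of_eq ?_) (h₁.trans herr)
    rw [← abs_neg]
    congr 1
    ring
  · refine le_trans (le_of_eq ?_) (h₀.trans herr)
    congr 1
    ring

end HP

end
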